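/- arXiv:1807.10373 — 5 statements merged into one kernel-verified Lean document; each statement's English description precedes it below -/
import Mathlib

section
/- (Schreyerfest-dinner theorem, apolar form.) Let F ∈ k[x₀,x₁,x₂,x₃] be a homogeneous cubic and let L be a 3-dimensional subspace of quadratic forms contained in the span of the directional derivatives {D_vF : v ∈ k⁴}. Then dim_k K(L) ≥ 3; that is, the image X_L of P³ under the second Veronese followed by projection from P(L) lies on an at least three-dimensional space of cubic hypersurfaces in P⁶. -/
open MvPolynomial

noncomputable section

variable {k : Type} [Field k]

/-- The constant-coefficient differential operator `∂^m` on `k[x₀,x₁,x₂,x₃]`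
associated to a monomial exponent vector `m`. -/
noncomputable def monD (k : Type) [Field k] (m : Fin 4 →₀ ℕ) :
    Module.End k (MvPolynomial (Fin 4) k) :=
  ((pderiv (0 : Fin 4)).toLinearMap) ^ (m 0) * ((pderiv 1).toLinearMap) ^ (m 1) *
    ((pderiv 2).toLinearMap) ^ (m 2) * ((pderiv 3).toLinearMap) ^ (m 3)

/-- The apolarity action `f(∂)(g)` of a polynomial `f` (viewed as a constant
coefficient differential operator) on a polynomial `g`. -/
noncomputable def diffOp (f g : MvPolynomial (Fin 4) k) : MvPolynomial (Fin 4) k :=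
  ∑ m ∈ f.support, (coeff m f) • (monD k m g)

/-- The apolar perpendicular of a space `L` of quadratic forms: all quadratic
forms `q` with `⟨q, f⟩ = q(∂)(f) = 0` for all `f ∈ L`. -/
def perpSet (L : Submodule k (MvPolynomial (Fin 4) k)) : Set (MvPolynomial (Fin 4) k) :=
  {q | q.IsHomogeneous 2 ∧ ∀ f ∈ L, diffOp q f = 0}

/-- `q : Fin 7 → k[x]₂` is a basis of `L^⊥`. -/
def IsPerpBasis (L : Submodule k (MvPolynomial (Fin 4) k))
    (q : Fin 7 → MvPolynomial (Fin 4) k) : Prop :=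
  LinearIndependent k q ∧
    (Submodule.span k (Set.range q) : Set (MvPolynomial (Fin 4) k)) = perpSet L

/-- `K(L)`: the space of homogeneous cubics `C ∈ k[y₀,…,y₆]` with `C(q₀,…,q₆) = 0`,
for a basis `q₀,…,q₆` of `L^⊥`; i.e. cubic hypersurfaces through the projected
Veronese `X_L`. -/
noncomputable def cubicRelations (q : Fin 7 → MvPolynomial (Fin 4) k) :
    Submodule k (MvPolynomial (Fin 7) k) :=
  (homogeneousSubmodule (Fin 7) k 3) ⊓ LinearMap.ker (aeval q).toLinearMap

/-- The symmetric Gram matrix of a quadratic form (characteristic ≠ 2). -/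
def gram (q : MvPolynomial (Fin 4) k) : Matrix (Fin 4) (Fin 4) k :=
  Matrix.of fun i j =>
    if i = j then coeff (Finsupp.single i 2) q
    else coeff (Finsupp.single i 1 + Finsupp.single j 1) q / 2

/-- The directional derivative `D_v = Σᵢ vᵢ ∂/∂xᵢ`. -/
noncomputable def dirDeriv (v : Fin 4 → k) (F : MvPolynomial (Fin 4) k) :
    MvPolynomial (Fin 4) k :=
  ∑ i, v i • pderiv i F


abbrev RR (k : Type) [Field k] := MvPolynomial (Fin 4) k

def NN (A : Fin 3 → (RR k →ₗ[k] k)) : Submodule k (RR k) :=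
  homogeneousSubmodule (Fin 4) k 2 ⊓ ⨅ l, LinearMap.ker (A l)

def Good (A : Fin 3 → (RR k →ₗ[k] k)) : Prop :=
  Module.finrank k (NN A ^ 3 : Submodule k (RR k)) ≤ 81

def Ind (A : Fin 3 → (RR k →ₗ[k] k)) : Prop :=
  ∃ r : Fin 3 → RR k, (∀ m, r m ∈ homogeneousSubmodule (Fin 4) k 2) ∧
    (Matrix.of fun l m => A l (r m)).det ≠ 0

lemma mem_NN {A : Fin 3 → (RR k →ₗ[k] k)} {p : RR k} :
    p ∈ NN A ↔ p.IsHomogeneous 2 ∧ ∀ l, A l p = 0 := by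
  simp [NN, mem_homogeneousSubmodule]

instance finHom (n d : ℕ) : Module.Finite k (homogeneousSubmodule (Fin n) k d) :=
  Module.Finite.iff_fg.2 (homogeneousSubmodule_fg _ k d)

lemma finrank_hom (n d : ℕ) :
    Module.finrank k (homogeneousSubmodule (Fin n) k d) = Nat.multichoose n d := by
  rw [homogeneousSubmodule_eq_finsupp_supported]
  have e := (AddMonoidAlgebra.supportedEquivFinsupp (S := k) (R := k) {d' : Fin n →₀ ℕ | d'.degree = d})
  have h : ({d' : Fin n →₀ ℕ | d'.degree = d}) = ((Finset.univ : Finset (Fin n)).finsuppAntidiag d : Set _) := by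
    ext x
    simp [Finset.mem_finsuppAntidiag, Finsupp.degree_eq_sum]
  refine (LinearEquiv.finrank_eq e).trans ?_
  rw [h]
  rw [Module.finrank_finsupp_self]
  simp [Finset.card_finsuppAntidiag_nat_eq_multichoose]

lemma subpow_le {B : Type} [CommRing B] [Algebra k B] {M N : Submodule k B} (h : M ≤ N) (n : ℕ) :
    M ^ n ≤ N ^ n := by
  induction n with
  | zero => simp
  | succ n ih => rw [pow_succ, pow_succ]; exact mul_le_mul' ih h

lemma NN_pow_le (A : Fin 3 → (RR k →ₗ[k] k)) :
    (NN A ^ 3 : Submodule k (RR k)) ≤ homogeneousSubmodule (Fin 4) k 6 := by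
  have h1 : (NN A ^ 3 : Submodule k (RR k)) ≤ (homogeneousSubmodule (Fin 4) k 2) ^ 3 :=
    subpow_le inf_le_left 3
  refine h1.trans ?_
  rw [← homogeneousSubmodule_one_pow (σ := Fin 4) (R := k) (n := 2), ← pow_mul, homogeneousSubmodule_one_pow]

instance finNN (A : Fin 3 → (RR k →ₗ[k] k)) :
    Module.Finite k (NN A ^ 3 : Submodule k (RR k)) :=
  Submodule.finiteDimensional_of_le (NN_pow_le A)

lemma good_of_le {A B : Fin 3 → (RR k →ₗ[k] k)} (h : NN B ≤ NN A) (hA : Good A) : Good B :=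
  (Submodule.finrank_mono (subpow_le h 3)).trans hA

/-- transport along a substitution -/
lemma good_transport {A : Fin 3 → (RR k →ₗ[k] k)} (f g : RR k →ₐ[k] RR k)
    (hfg : ∀ p, f (g p) = p) (hg : ∀ p : RR k, p.IsHomogeneous 2 → (g p).IsHomogeneous 2)
    (h : Good (fun l => (A l).comp f.toLinearMap)) : Good A := by
  have h1 : NN A ≤ (NN (fun l => (A l).comp f.toLinearMap)).map f.toLinearMap := by
    intro p hp
    rw [mem_NN] at hp
    refine ⟨g p, ?_, hfg p⟩
    simp only [SetLike.mem_coe, mem_NN]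
    exact ⟨hg p hp.1, fun l => by simp [hfg, hp.2 l]⟩
  have h2 := subpow_le h1 3
  rw [← Submodule.map_pow] at h2
  unfold Good at h ⊢
  refine (Submodule.finrank_mono h2).trans ((Submodule.finrank_map_le _ _).trans h)

lemma ind_transport {A : Fin 3 → (RR k →ₗ[k] k)} (f g : RR k →ₐ[k] RR k)
    (hfg : ∀ p, f (g p) = p) (hg : ∀ p : RR k, p.IsHomogeneous 2 → (g p).IsHomogeneous 2)
    (h : Ind A) : Ind (fun l => (A l).comp f.toLinearMap) := by
  obtain ⟨r, hr, hd⟩ := h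
  refine ⟨fun m => g (r m), fun m => hg _ (hr m), ?_⟩
  simpa [hfg] using hd

/-- linear forms -/
def lf (v : Fin 4 → k) : RR k := ∑ j, v j • X j

lemma lf_hom (v : Fin 4 → k) : (lf v).IsHomogeneous 1 := by
  refine IsHomogeneous.sum _ _ _ fun j _ => ?_
  rw [smul_eq_C_mul]
  exact isHomogeneous_C_mul_X _ _

def lsub (P : Matrix (Fin 4) (Fin 4) k) : RR k →ₐ[k] RR k := aeval fun i => lf (P i)

lemma lsub_hom (P : Matrix (Fin 4) (Fin 4) k) (p : RR k) (n : ℕ) (hp : p.IsHomogeneous n) :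
    (lsub P p).IsHomogeneous n := by
  have := hp.aeval (fun i => lf (P i)) (n := 1) (fun i => lf_hom _)
  simpa [lsub] using this

lemma lsub_lsub (P Q : Matrix (Fin 4) (Fin 4) k) (h : Q * P = 1) (p : RR k) :
    lsub P (lsub Q p) = p := by
  have : (lsub P).comp (lsub Q) = AlgHom.id k _ := by
    ext1 i
    simp only [lsub, AlgHom.comp_apply, aeval_X, lf, map_sum, map_smul, AlgHom.id_apply]
    simp only [Finset.smul_sum, smul_smul]
    rw [Finset.sum_comm]
    simp only [← Finset.sum_smul]
    have : ∀ j, ∑ x, Q i x * P x j = (1 : Matrix (Fin 4) (Fin 4) k) i j := by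
      intro j; rw [← h, Matrix.mul_apply]
    simp [this, Matrix.one_apply]
  exact DFunLike.congr_fun this p

/-- two functionals agreeing on products of variables agree on quadrics -/
lemma quad_ext {f g : RR k →ₗ[k] k} (h : ∀ i j, f (X i * X j) = g (X i * X j)) {p : RR k}
    (hp : p.IsHomogeneous 2) : f p = g p := by
  have hp' : p ∈ homogeneousSubmodule (Fin 4) k 2 := hp
  rw [← homogeneousSubmodule_one_pow, homogeneousSubmodule_one_eq_span_X, pow_two,
    Submodule.span_mul_span] at hp'
  refine LinearMap.eqOn_span' (f := f) (g := g) ?_ hp'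
  rintro _ ⟨_, ⟨i, rfl⟩, _, ⟨j, rfl⟩, rfl⟩
  exact h i j

/-! Hankel nets -/

open Polynomial in
def rho (k : Type) [Field k] : RR k →ₐ[k] Polynomial k := aeval fun i => (Polynomial.X : Polynomial k) ^ (i : ℕ)

def hank (η : Polynomial k →ₗ[k] k) (l : Fin 3) : RR k →ₗ[k] k :=
  η.comp ((LinearMap.mulLeft k ((Polynomial.X : Polynomial k) ^ (l : ℕ))).comp (rho k).toLinearMap)

lemma hank_apply (η : Polynomial k →ₗ[k] k) (l : Fin 3) (p : RR k) :
    hank η l p = η (Polynomial.X ^ (l : ℕ) * rho k p) := rfl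

lemma hank_XX (η : Polynomial k →ₗ[k] k) (l : Fin 3) (i j : Fin 4) :
    hank η l (X i * X j) = η (Polynomial.X ^ ((l : ℕ) + i + j)) := by
  simp [hank_apply, rho, pow_add, mul_assoc]

lemma rho_deg {p : RR k} {n : ℕ} (hp : p.IsHomogeneous n) :
    rho k p ∈ Polynomial.degreeLT k (3 * n + 1) := by
  rw [rho, aeval_def, eval₂_eq]
  refine Submodule.sum_mem _ fun d hd => ?_
  have h : d.degree = n := by
    by_contra hc
    exact (mem_support_iff.1 hd) (hp.coeff_eq_zero hc)
  rw [Finsupp.degree_eq_sum, Fin.sum_univ_four] at h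
  have hpr : ∏ i ∈ d.support, ((Polynomial.X : Polynomial k) ^ (i : ℕ)) ^ d i =
      ∏ i : Fin 4, ((Polynomial.X : Polynomial k) ^ (i : ℕ)) ^ d i := by
    apply Finset.prod_subset (Finset.subset_univ _)
    intro i _ hi
    rw [Finsupp.notMem_support_iff.1 hi, pow_zero]
  rw [hpr]
  rw [Polynomial.mem_degreeLT]
  rw [Fin.prod_univ_four, Polynomial.algebraMap_apply, Algebra.algebraMap_self, RingHom.id_apply]
  simp only [← pow_mul, ← pow_add]
  refine (Polynomial.degree_C_mul_X_pow_le _ _).trans_lt ?_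
  norm_cast
  simp
  omega

lemma finrank_degLT (n : ℕ) : Module.finrank k (Polynomial.degreeLT k n) = n := by
  rw [(Polynomial.degreeLTEquiv k n).finrank_eq]; simp

instance finDegLT (n : ℕ) : Module.Finite k (Polynomial.degreeLT k n) :=
  Module.Finite.equiv (Polynomial.degreeLTEquiv k n).symm

lemma rho_surj : Polynomial.degreeLT k 19 ≤ (homogeneousSubmodule (Fin 4) k 6).map (rho k).toLinearMap := by
  classical
  rw [Polynomial.degreeLT_eq_span_X_pow, Submodule.span_le]
  intro f hf
  simp only [Finset.coe_image, Finset.coe_range, Set.mem_image, Set.mem_Iio] at hf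
  obtain ⟨n, hn, rfl⟩ := hf
  have key : ∀ a b c d : Fin 4, ∀ i j : Fin 4, (a : ℕ) + b + c + d + i + j = n →
      (Polynomial.X : Polynomial k) ^ n ∈ (homogeneousSubmodule (Fin 4) k 6).map (rho k).toLinearMap := by
    intro a b c d i j h
    refine ⟨X a * X b * X c * X d * X i * X j, ?_, ?_⟩
    · have h1 := fun i => isHomogeneous_X k (σ := Fin 4) i
      exact (((((h1 a).mul (h1 b)).mul (h1 c)).mul (h1 d)).mul (h1 i)).mul (h1 j)
    · simp [rho, ← h, pow_add]
  have : ∃ a b c d i j : Fin 4, (a : ℕ) + b + c + d + i + j = n := by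
    have h6 : ∀ m : ℕ, m < 7 → ∃ a b : Fin 4, (a : ℕ) + b = m := by decide
    obtain ⟨a, b, h⟩ := h6 (min n 6) (by omega)
    obtain ⟨c, d, h'⟩ := h6 (min (n - 6) 6) (by omega)
    obtain ⟨i, j, h''⟩ := h6 (n - 12) (by omega)
    exact ⟨a, b, c, d, i, j, by omega⟩
  obtain ⟨a, b, c, d, i, j, h⟩ := this
  exact key a b c d i j h

lemma rank_null {V W : Type} [AddCommGroup V] [Module k V] [AddCommGroup W] [Module k W]
    (M : Submodule k V) [Module.Finite k M] (f : V →ₗ[k] W) :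
    Module.finrank k (M.map f) + Module.finrank k (M ⊓ LinearMap.ker f : Submodule k V) =
      Module.finrank k M := by
  have h := LinearMap.finrank_range_add_finrank_ker (f.domRestrict M)
  rw [LinearMap.range_domRestrict] at h
  rw [← h, ← Submodule.finrank_map_subtype_eq M (LinearMap.ker (f.domRestrict M)),
    LinearMap.ker_domRestrict]
  congr 1
  refine congrArg (fun N : Submodule k V => Module.finrank k N) ?_
  exact (Submodule.map_comap_subtype M (LinearMap.ker f)).symm

lemma finrank_ker_rho :
    Module.finrank k (homogeneousSubmodule (Fin 4) k 6 ⊓ LinearMap.ker (rho k).toLinearMap :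
      Submodule k (RR k)) ≤ 65 := by
  have h := rank_null (homogeneousSubmodule (Fin 4) k 6) (rho k).toLinearMap
  have h2 := Submodule.finrank_mono (rho_surj (k := k))
  rw [finrank_degLT] at h2
  rw [finrank_hom] at h
  have : Nat.multichoose 4 6 = 84 := by rw [Nat.multichoose_eq]; decide
  rw [this] at h
  exact (by omega : ∀ a x : ℕ, a + x = 84 → 19 ≤ a → x ≤ 65) _ _ h h2

lemma exists_two {V : Type} [AddCommGroup V] [Module k V] (U : Submodule k V) [Module.Finite k U]
   (h : 2 ≤ Module.finrank k U) : ∃ a ∈ U, ∃ b ∈ U, LinearIndependent k ![a, b] := by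
  obtain ⟨f, hf⟩ := exists_linearIndependent_of_le_finrank h
  refine ⟨f 0, (f 0).2, f 1, (f 1).2, ?_⟩
  have := hf.map' U.subtype U.ker_subtype
  have e : ![((f 0 : U) : V), ((f 1 : U) : V)] = (⇑U.subtype ∘ f) := by
    ext i; fin_cases i <;> rfl
  rw [e]
  exact this

lemma cube_le {a b : Polynomial k} {T : Submodule k (Polynomial k)}
    (hT : T ≤ Submodule.span k (Set.range fun x : Fin 2 × Fin 2 => ![a, b] x.1 * Polynomial.X ^ (x.2 : ℕ))) :
    Module.finrank k (T ^ 3 : Submodule k (Polynomial k)) ≤ 16 := by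
  have h1 : (T ^ 3 : Submodule k (Polynomial k)) ≤ Submodule.span k (Set.range fun x : Fin 4 × Fin 4 =>
      a ^ (x.1 : ℕ) * b ^ (3 - (x.1 : ℕ)) * Polynomial.X ^ (x.2 : ℕ)) := by
    refine (subpow_le hT 3).trans ?_
    rw [pow_succ, pow_two, Submodule.span_mul_span, Submodule.span_mul_span, Submodule.span_le]
    rintro _ ⟨_, ⟨_, ⟨⟨i, i'⟩, rfl⟩, _, ⟨⟨j, j'⟩, rfl⟩, rfl⟩, _, ⟨⟨l, l'⟩, rfl⟩, rfl⟩
    refine Submodule.subset_span ⟨(⟨3 - (i + j + l : ℕ), by omega⟩, ⟨i' + j' + l', by omega⟩), ?_⟩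
    simp only [pow_add]
    fin_cases i <;> fin_cases j <;> fin_cases l <;> simp <;> ring
  have : Module.Finite k (Submodule.span k (Set.range fun x : Fin 4 × Fin 4 =>
      a ^ (x.1 : ℕ) * b ^ (3 - (x.1 : ℕ)) * Polynomial.X ^ (x.2 : ℕ))) :=
    FiniteDimensional.span_of_finite k (Set.finite_range _)
  refine (Submodule.finrank_mono h1).trans ((finrank_range_le_card _).trans ?_)
  simp

lemma pi_ker {V : Type} [AddCommGroup V] [Module k V] {n : ℕ} (f : Fin n → (V →ₗ[k] k)) (M : Submodule k V)
    [Module.Finite k M] :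
    Module.finrank k M ≤ n + Module.finrank k (M ⊓ ⨅ i, LinearMap.ker (f i) : Submodule k V) := by
  have h := rank_null M (LinearMap.pi f)
  rw [LinearMap.ker_pi] at h
  have := Submodule.finrank_le (M.map (LinearMap.pi f))
  simp at this
  omega

def TT (η : Polynomial k →ₗ[k] k) : Submodule k (Polynomial k) := Polynomial.degreeLT k 7 ⊓
    ⨅ l : Fin 3, LinearMap.ker (η.comp (LinearMap.mulLeft k ((Polynomial.X : Polynomial k) ^ (l : ℕ))))

lemma mem_TT (η : Polynomial k →ₗ[k] k) (a : Polynomial k) :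
    a ∈ TT η ↔ a ∈ Polynomial.degreeLT k 7 ∧ ∀ l : Fin 3, η (Polynomial.X ^ (l : ℕ) * a) = 0 := by
  simp [TT]

instance finTT (η : Polynomial k →ₗ[k] k) : Module.Finite k (TT η) :=
  Submodule.finiteDimensional_of_le (inf_le_left : TT η ≤ Polynomial.degreeLT k 7)

lemma TT_cube (η : Polynomial k →ₗ[k] k)
    (hη : ∀ a ∈ Polynomial.degreeLT k 5, (∀ l : Fin 5, η (Polynomial.X ^ (l : ℕ) * a) = 0) → a = 0) :
    Module.finrank k (TT η ^ 3 : Submodule k (Polynomial k)) ≤ 16 := by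
  let U : Submodule k (Polynomial k) := Polynomial.degreeLT k 6 ⊓
    ⨅ l : Fin 4, LinearMap.ker (η.comp (LinearMap.mulLeft k ((Polynomial.X : Polynomial k) ^ (l : ℕ))))
  set T := TT η with hTdef
  have memU : ∀ a, a ∈ U ↔ a ∈ Polynomial.degreeLT k 6 ∧ ∀ l : Fin 4, η (Polynomial.X ^ (l : ℕ) * a) = 0 := by
    intro a; simp [U]
  have memT : ∀ a, a ∈ T ↔ a ∈ Polynomial.degreeLT k 7 ∧ ∀ l : Fin 3, η (Polynomial.X ^ (l : ℕ) * a) = 0 := by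
    exact mem_TT η
  have hshift : ∀ (a : Polynomial k) (n : ℕ), Polynomial.X ^ n * (Polynomial.X * a) = Polynomial.X ^ (n + 1) * a := by
    intro a n; ring
  have hU : 2 ≤ Module.finrank k U := by
    have := pi_ker (fun l : Fin 4 => η.comp (LinearMap.mulLeft k ((Polynomial.X : Polynomial k) ^ (l : ℕ))))
      (Polynomial.degreeLT k 6)
    rw [finrank_degLT] at this
    change 6 ≤ 4 + Module.finrank k U at this
    omega
  have hT : Module.finrank k T ≤ 4 := by
    let g : Polynomial k →ₗ[k] (Fin 5 → k) := LinearMap.pi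
      (fun l : Fin 5 => η.comp (LinearMap.mulLeft k ((Polynomial.X : Polynomial k) ^ (l : ℕ))))
    have h5 := rank_null (Polynomial.degreeLT k 5) g
    have h0 : (Polynomial.degreeLT k 5 ⊓ LinearMap.ker g : Submodule k (Polynomial k)) = ⊥ := by
      rw [eq_bot_iff]
      rintro a ⟨ha, ha'⟩
      refine hη a ha fun l => ?_
      exact congrFun ha' l
    rw [h0, finrank_bot, finrank_degLT] at h5
    have htop : (Polynomial.degreeLT k 5).map g = ⊤ := by
      apply Submodule.eq_top_of_finrank_eq
      simp; omega
    have h3 := rank_null (Polynomial.degreeLT k 7) (LinearMap.pi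
      (fun l : Fin 3 => η.comp (LinearMap.mulLeft k ((Polynomial.X : Polynomial k) ^ (l : ℕ)))))
    have htop' : (Polynomial.degreeLT k 7).map (LinearMap.pi
      (fun l : Fin 3 => η.comp (LinearMap.mulLeft k ((Polynomial.X : Polynomial k) ^ (l : ℕ))))) = ⊤ := by
      rw [eq_top_iff]
      rintro c -
      have hc : (![c 0, c 1, c 2, 0, 0] : Fin 5 → k) ∈ (Polynomial.degreeLT k 5).map g := by
        rw [htop]; trivial
      obtain ⟨a, ha, hac⟩ := hc
      refine ⟨a, Polynomial.degreeLT_mono (by norm_num) ha, ?_⟩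
      ext l
      fin_cases l
      · exact congrFun hac 0
      · exact congrFun hac 1
      · exact congrFun hac 2
    rw [htop', finrank_degLT, LinearMap.ker_pi, finrank_top] at h3
    change _ + Module.finrank k T = 7 at h3
    simp at h3
    omega
  have : Module.Finite k U := Submodule.finiteDimensional_of_le (inf_le_left : U ≤ Polynomial.degreeLT k 6)
  obtain ⟨a, ha, b, hb, hab⟩ := exists_two U hU
  have hUT : ∀ c ∈ U, c ∈ T := by
    intro c hc
    rw [memU] at hc; rw [memT]
    exact ⟨Polynomial.degreeLT_mono (by norm_num) hc.1, fun l => by simpa using hc.2 l.castSucc⟩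
  have hUT' : ∀ c ∈ U, Polynomial.X * c ∈ T := by
    intro c hc
    rw [memU] at hc; rw [memT]
    refine ⟨?_, fun l => by simpa [hshift] using hc.2 l.succ⟩
    have := hc.1
    by_cases h0 : c = 0
    · simp [h0]
    rw [Polynomial.mem_degreeLT] at this ⊢
    rw [Polynomial.degree_mul, Polynomial.degree_X]
    rw [Polynomial.degree_eq_natDegree h0] at this ⊢
    norm_cast at this ⊢
    omega
  have hUU : ∀ c ∈ U, Polynomial.X * c ∈ U → c = 0 := by
    intro c hc hc'
    rw [memU] at hc hc'
    refine hη c ?_ fun l => ?_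
    · have := hc'.1
      by_cases h0 : c = 0
      · simp [h0]
      rw [Polynomial.mem_degreeLT] at this ⊢
      rw [Polynomial.degree_mul, Polynomial.degree_X] at this
      rw [Polynomial.degree_eq_natDegree h0] at this ⊢
      norm_cast at this ⊢
      omega
    · refine Fin.cases ?_ (fun l => ?_) l
      · exact hc.2 0
      · simpa [hshift] using hc'.2 l
  have hli : LinearIndependent k ![a, b, Polynomial.X * a, Polynomial.X * b] := by
    rw [LinearIndependent.pair_iff] at hab
    rw [Fintype.linearIndependent_iff]
    intro g hg
    simp only [Fin.sum_univ_four] at hg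
    change g 0 • a + g 1 • b + g 2 • (Polynomial.X * a) + g 3 • (Polynomial.X * b) = 0 at hg
    have e1 : g 2 • a + g 3 • b = 0 := by
      apply hUU _ (add_mem (U.smul_mem _ ha) (U.smul_mem _ hb))
      have : Polynomial.X * (g 2 • a + g 3 • b) = (-g 0) • a + (-g 1) • b := by
        rw [mul_add, mul_smul_comm, mul_smul_comm, neg_smul, neg_smul]
        linear_combination hg
      rw [this]
      exact (add_mem (U.smul_mem _ ha) (U.smul_mem _ hb))
    have e2 := hab _ _ e1
    rw [e2.1, e2.2] at hg
    have e3 := hab (g 0) (g 1) (by simpa using hg)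
    intro i
    fin_cases i
    exacts [e3.1, e3.2, e2.1, e2.2]
  have hle : Submodule.span k (Set.range ![a, b, Polynomial.X * a, Polynomial.X * b]) ≤ T := by
    rw [Submodule.span_le]
    rintro _ ⟨i, rfl⟩
    fin_cases i
    exacts [hUT _ ha, hUT _ hb, hUT' _ ha, hUT' _ hb]
  have heq := Submodule.eq_of_le_of_finrank_le hle (by
    rw [finrank_span_eq_card hli]; simpa using hT)
  apply cube_le (a := a) (b := b)
  rw [← heq]
  apply Submodule.span_mono
  rintro _ ⟨i, rfl⟩
  fin_cases i
  · exact ⟨(0, 0), by simp⟩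
  · exact ⟨(1, 0), by simp⟩
  · exact ⟨(0, 1), by simp [mul_comm]⟩
  · exact ⟨(1, 1), by simp [mul_comm]⟩

lemma hank_good (η : Polynomial k →ₗ[k] k)
    (hη : ∀ a ∈ Polynomial.degreeLT k 5, (∀ l : Fin 5, η (Polynomial.X ^ (l : ℕ) * a) = 0) → a = 0) :
    Good (hank η) := by
  have hT3 := TT_cube η hη
  have hN : (NN (hank η)).map (rho k).toLinearMap ≤ TT η := by
    rintro _ ⟨p, hp, rfl⟩
    have hp' := mem_NN.1 hp
    rw [mem_TT]
    refine ⟨?_, fun l => ?_⟩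
    · have := rho_deg hp'.1
      exact this
    · have := hp'.2 l
      rw [hank_apply] at this
      exact this
  have hr := rank_null (NN (hank η) ^ 3) (rho k).toLinearMap
  have h1 : Module.finrank k ((NN (hank η) ^ 3).map (rho k).toLinearMap) ≤ 16 := by
    rw [Submodule.map_pow]
    have : Module.Finite k (TT η ^ 3 : Submodule k (Polynomial k)) := 
      Module.Finite.iff_fg.2 (Submodule.FG.pow (Module.Finite.iff_fg.1 inferInstance) 3)
    exact (Submodule.finrank_mono (subpow_le hN 3)).trans hT3
  have h2 : Module.finrank k (NN (hank η) ^ 3 ⊓ LinearMap.ker (rho k).toLinearMap : Submodule k (RR k)) ≤ 65 :=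
    (Submodule.finrank_mono (inf_le_inf_right _ (NN_pow_le _))).trans finrank_ker_rho
  unfold Good
  omega


/-- polynomial families -/
def PF {B : Type} [CommRing B] [Algebra k B] (b : k → B) : Prop :=
  ∃ P : Polynomial B, ∀ ε, b ε = P.eval (algebraMap k B ε)

section pf
variable {B : Type} [CommRing B] [Algebra k B]

lemma PF.const (b : B) : PF (fun _ : k => b) := ⟨Polynomial.C b, fun ε => by simp⟩

lemma PF.idd : PF (fun ε : k => ε) := ⟨Polynomial.X, fun ε => by simp⟩

lemma PF.add {b c : k → B} (hb : PF b) (hc : PF c) : PF (fun ε => b ε + c ε) := by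
  obtain ⟨P, hP⟩ := hb
  obtain ⟨Q, hQ⟩ := hc
  exact ⟨P + Q, fun ε => by simp [hP, hQ]⟩

lemma PF.mul {b c : k → B} (hb : PF b) (hc : PF c) : PF (fun ε => b ε * c ε) := by
  obtain ⟨P, hP⟩ := hb
  obtain ⟨Q, hQ⟩ := hc
  exact ⟨P * Q, fun ε => by simp [hP, hQ]⟩

lemma PF.smul {c : k → k} {b : k → B} (hc : PF c) (hb : PF b) : PF (fun ε => c ε • b ε) := by
  obtain ⟨P, hP⟩ := hb
  obtain ⟨Q, hQ⟩ := hc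
  refine ⟨(Q.map (algebraMap k B)) * P, fun ε => ?_⟩
  simp [hP, hQ, Algebra.smul_def, Polynomial.eval_map_algebraMap, Polynomial.aeval_algebraMap_apply]

lemma PF.neg {b : k → B} (hb : PF b) : PF (fun ε => - b ε) := by
  obtain ⟨P, hP⟩ := hb
  exact ⟨-P, fun ε => by simp [hP]⟩

lemma PF.sub {b c : k → B} (hb : PF b) (hc : PF c) : PF (fun ε => b ε - c ε) := by
  simpa [sub_eq_add_neg] using hb.add hc.neg

lemma PF.sum {ι : Type} (s : Finset ι) {b : ι → k → B} (hb : ∀ i, PF (b i)) :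
    PF (fun ε => ∑ i ∈ s, b i ε) := by
  choose P hP using hb
  exact ⟨∑ i ∈ s, P i, fun ε => by simp [hP, Polynomial.eval_finsetSum]⟩

lemma PF.prod {ι : Type} (s : Finset ι) {b : ι → k → B} (hb : ∀ i, PF (b i)) :
    PF (fun ε => ∏ i ∈ s, b i ε) := by
  choose P hP using hb
  exact ⟨∏ i ∈ s, P i, fun ε => by simp [hP, Polynomial.eval_prod]⟩

lemma PF.lin {b : k → B} (φ : B →ₗ[k] k) (hb : PF b) : PF (fun ε => φ (b ε)) := by
  obtain ⟨P, hP⟩ := hb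
  refine ⟨∑ i ∈ P.support, Polynomial.C (φ (P.coeff i)) * Polynomial.X ^ i, fun ε => ?_⟩
  change φ (b ε) = _
  rw [hP, Polynomial.eval_eq_sum, Polynomial.sum, map_sum, Polynomial.eval_finsetSum]
  refine Finset.sum_congr rfl fun i _ => ?_
  rw [← map_pow, mul_comm, ← Algebra.smul_def, map_smul]
  simp only [smul_eq_mul, Algebra.algebraMap_self, RingHom.id_apply, Polynomial.eval_mul,
    Polynomial.eval_C, Polynomial.eval_pow, Polynomial.eval_X]
  exact mul_comm _ _

lemma PF.det {n : Type} [Fintype n] [DecidableEq n] {M : k → Matrix n n B}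
    (h : ∀ i j, PF (fun ε => M ε i j)) : PF (fun ε => (M ε).det) := by
  simp only [Matrix.det_apply, Units.smul_def, zsmul_eq_mul]
  exact PF.sum _ fun σ => (PF.const _).mul (PF.prod _ fun i => h _ _)

lemma PF.adj {n : Type} [Fintype n] [DecidableEq n] {M : k → Matrix n n B}
    (h : ∀ i j, PF (fun ε => M ε i j)) (i j : n) : PF (fun ε => (M ε).adjugate i j) := by
  simp only [Matrix.adjugate_apply]
  refine PF.det fun a b => ?_
  by_cases ha : a = j
  · subst ha
    simpa using PF.const _
  · simpa [Matrix.updateRow_ne ha] using h a b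

lemma PF.ev {c : k → k} (hc : PF c) (h0 : c 0 ≠ 0) : ∀ᶠ ε in Filter.cofinite, c ε ≠ 0 := by
  obtain ⟨P, hP⟩ := hc
  have hP0 : P ≠ 0 := by
    rintro rfl
    apply h0; simp [hP]
  rw [Filter.eventually_cofinite]
  refine (P.rootSet_finite k).subset fun x hx => ?_
  rw [Polynomial.mem_rootSet]
  refine ⟨hP0, ?_⟩
  simp only [Set.mem_ofPred_eq, not_not] at hx
  rw [hP] at hx
  simpa using hx

lemma PF.li {n : ℕ} {b : Fin n → k → B} (hb : ∀ i, PF (b i))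
    (h0 : LinearIndependent k fun i => b i 0) :
    ∀ᶠ ε in Filter.cofinite, LinearIndependent k fun i => b i ε := by
  have h : ∃ φ : Fin n → (B →ₗ[k] k), ∀ i j, φ j (b i 0) = if i = j then 1 else 0 := by
    obtain ⟨g, hg⟩ := LinearMap.exists_leftInverse_of_injective
      (Fintype.linearCombination k (fun i => b i 0)) (by
        rw [LinearMap.ker_eq_bot]; exact h0.fintypeLinearCombination_injective)
    refine ⟨fun j => (LinearMap.proj j).comp g, fun i j => ?_⟩
    have := LinearMap.congr_fun hg (Pi.single i 1)
    simp [Fintype.linearCombination_apply_single] at this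
    simp [this, Pi.single_apply, eq_comm]
  obtain ⟨φ, hφ⟩ := h
  have := PF.ev (c := fun ε => (Matrix.of fun i j => φ j (b i ε)).det)
    (PF.det fun i j => by simpa using (hb i).lin (φ j)) (by
      have : (Matrix.of fun i j => φ j (b i 0)) = 1 := by
        ext i j; simp [hφ, Matrix.one_apply]
      simp [this])
  filter_upwards [this] with ε hε
  rw [Fintype.linearIndependent_iff]
  intro g hg
  have hv : Matrix.vecMul g (Matrix.of fun i j => φ j (b i ε)) = 0 := by
    ext j
    have := congrArg (φ j) hg
    simpa [Matrix.vecMul, dotProduct] using this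
  have := Matrix.eq_zero_of_vecMul_eq_zero hε hv
  exact fun i => congrFun this i
end pf

lemma exists_li {V : Type} [AddCommGroup V] [Module k V] (s : Set V) (n : ℕ)
    (h : n ≤ Module.finrank k (Submodule.span k s)) :
    ∃ v : Fin n → V, (∀ i, v i ∈ s) ∧ LinearIndependent k v := by
  obtain ⟨b, hbs, hsp, hli⟩ := exists_linearIndependent k s
  rw [← hsp] at h
  have hc : (n : Cardinal) ≤ Cardinal.mk b := by
    have h1 := rank_span_set hli
    have h2 : (Module.finrank k (Submodule.span k b) : Cardinal) ≤ Module.rank k (Submodule.span k b) :=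
      Cardinal.natCast_toNat_le _
    rw [h1] at h2
    exact le_trans (by exact_mod_cast h) h2
  rw [← Cardinal.mk_fin, Cardinal.le_def] at hc
  obtain ⟨e⟩ := hc
  exact ⟨fun i => e i, fun i => hbs (e i).2, hli.comp e e.injective⟩

lemma cube_span {B : Type} [CommRing B] [Algebra k B] (M : Submodule k B) :
    M ^ 3 = Submodule.span k {x | ∃ a ∈ M, ∃ b ∈ M, ∃ c ∈ M, x = a * b * c} := by
  apply le_antisymm
  · rw [pow_succ, pow_two]
    rw [Submodule.mul_le]
    intro m hm c hc
    refine Submodule.mul_induction_on (C := fun m => m * c ∈ _) hm ?_ ?_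
    · intro a ha b hb
      exact Submodule.subset_span ⟨a, ha, b, hb, c, hc, rfl⟩
    · intro x y hx hy
      rw [add_mul]; exact add_mem hx hy
  · rw [Submodule.span_le]
    rintro _ ⟨a, ha, b, hb, c, hc, rfl⟩
    rw [pow_succ, pow_two]
    exact Submodule.mul_mem_mul (Submodule.mul_mem_mul ha hb) hc

lemma semicont [Infinite k] {A B : Fin 3 → (RR k →ₗ[k] k)} (hA : Ind A)
    (h : ∀ᶠ ε in Filter.cofinite, Good (fun l => B l + (ε : k) • A l)) : Good A := by
  obtain ⟨r, hr, hd⟩ := hA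
  by_contra hG
  unfold Good at hG
  rw [not_le, cube_span] at hG
  obtain ⟨v, hv, hli⟩ := exists_li _ 82 hG
  choose p hp q hq s hs hv using hv
  set M : k → Matrix (Fin 3) (Fin 3) k := fun ε => Matrix.of fun l m => (A l + ε • B l) (r m) with hM
  have hMPF : ∀ i j, PF fun ε => M ε i j := fun i j => by
    simp only [hM, Matrix.of_apply, LinearMap.add_apply, LinearMap.smul_apply, smul_eq_mul]
    exact (PF.const _).add (PF.idd.mul (PF.const _))
  let pt : RR k → k → RR k := fun p ε => (M ε).det • p -
    ∑ m, (∑ l, (M ε).adjugate m l * (ε * B l p)) • r m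
  have hptPF : ∀ p, PF (pt p) := fun p =>
    ((PF.det hMPF).smul (PF.const _)).sub (PF.sum _ fun m => PF.smul
      (PF.sum _ fun l => (PF.adj hMPF _ _).mul (PF.idd.mul (PF.const _))) (PF.const _))
  have hpt0 : ∀ p, pt p 0 = (M 0).det • p := fun p => by simp [pt]
  have hptN : ∀ p ∈ NN A, ∀ ε, pt p ε ∈ NN (fun l => A l + ε • B l) := by
    intro p hp ε
    rw [mem_NN] at hp ⊢
    constructor
    · rw [← mem_homogeneousSubmodule]
      exact sub_mem (Submodule.smul_mem _ _ hp.1) (sum_mem fun m _ => Submodule.smul_mem _ _ (hr m))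
    · intro l
      simp only [pt, map_sub, map_smul, map_sum, smul_eq_mul]
      have e1 : (A l + ε • B l) p = ε * B l p := by simp [hp.2 l]
      have e2 : ∑ m, (∑ l', (M ε).adjugate m l' * (ε * B l' p)) * (A l + ε • B l) (r m)
          = (M ε).mulVec ((M ε).adjugate.mulVec fun l' => ε * B l' p) l := by
        simp [Matrix.mulVec, dotProduct, hM, mul_comm]
      rw [e1, e2, Matrix.mulVec_mulVec, Matrix.mul_adjugate, Matrix.smul_mulVec, Matrix.one_mulVec]
      simp
  have hd0 : (M 0).det ≠ 0 := by simpa [hM] using hd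
  have hev := PF.li (k := k) (B := RR k) (n := 82) (b := fun i ε => pt (p i) ε * pt (q i) ε * pt (s i) ε)
    (fun i => ((hptPF _).mul (hptPF _)).mul (hptPF _)) (by
      have : (fun i => pt (p i) 0 * pt (q i) 0 * pt (s i) 0) = fun i => ((M 0).det ^ 3) • v i := by
        ext1 i
        simp only [hpt0, hv, Algebra.smul_mul_assoc, Algebra.mul_smul_comm, smul_smul]
        congr 1; ring
      rw [this]
      exact hli.units_smul (fun _ => Units.mk0 _ (pow_ne_zero 3 hd0)))
  have hinv : ∀ᶠ ε in Filter.cofinite, Good (fun l => B l + (ε⁻¹ : k) • A l) :=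
    (inv_injective.tendsto_cofinite).eventually h
  have hne : ∀ᶠ ε in Filter.cofinite, ε ≠ (0 : k) := by
    rw [Filter.eventually_cofinite]; simp
  obtain ⟨ε, h1, h2, h3⟩ := (hev.and (hinv.and hne)).exists
  have hle : NN (fun l => A l + ε • B l) ≤ NN (fun l => B l + (ε⁻¹ : k) • A l) := by
    intro x hx
    rw [mem_NN] at hx ⊢
    refine ⟨hx.1, fun l => ?_⟩
    have := hx.2 l
    simp only [LinearMap.add_apply, LinearMap.smul_apply, smul_eq_mul] at this ⊢
    field_simp
    linear_combination this
  have hG' := good_of_le hle h2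
  unfold Good at hG'
  have hspan : Submodule.span k (Set.range fun i => pt (p i) ε * pt (q i) ε * pt (s i) ε) ≤
      NN (fun l => A l + ε • B l) ^ 3 := by
    rw [cube_span]
    apply Submodule.span_mono
    rintro _ ⟨i, rfl⟩
    exact ⟨_, hptN _ (hp i) ε, _, hptN _ (hq i) ε, _, hptN _ (hs i) ε, rfl⟩
  have := Submodule.finrank_mono hspan
  rw [finrank_span_eq_card h1, Fintype.card_fin] at this
  omega

lemma hank_nondeg (η : Polynomial k →ₗ[k] k)
    (h : (Matrix.of fun l j : Fin 5 => η (Polynomial.X ^ ((l : ℕ) + j))).det ≠ 0) :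
    ∀ a ∈ Polynomial.degreeLT k 5, (∀ l : Fin 5, η (Polynomial.X ^ (l : ℕ) * a) = 0) → a = 0 := by
  intro a ha hl
  have hdeg : a.natDegree < 5 := by
    by_cases h0 : a = 0
    · simp [h0]
    · rw [Polynomial.mem_degreeLT, Polynomial.degree_eq_natDegree h0] at ha
      exact_mod_cast ha
  have hsum : a = ∑ j : Fin 5, a.coeff j • (Polynomial.X : Polynomial k) ^ (j : ℕ) := by
    conv_lhs => rw [a.as_sum_range' 5 hdeg]
    rw [Finset.sum_range]
    simp [Polynomial.smul_X_eq_monomial]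
  have hz := Matrix.eq_zero_of_mulVec_eq_zero h (v := fun j : Fin 5 => a.coeff j) (by
    ext l
    have := hl l
    rw [hsum, Finset.mul_sum, map_sum] at this
    simp only [Matrix.mulVec, dotProduct, Matrix.of_apply, Pi.zero_apply]
    rw [← this]
    refine Finset.sum_congr rfl fun j _ => ?_
    rw [mul_smul_comm, map_smul, ← pow_add, smul_eq_mul, mul_comm])
  rw [hsum]
  refine Finset.sum_eq_zero fun j _ => ?_
  have := congrFun hz j
  simp only [Pi.zero_apply] at this
  rw [this, zero_smul]

lemma anti_det : (Matrix.of fun l j : Fin 5 => if (4 : ℕ) = (l : ℕ) + j then (1 : k) else 0).det ≠ 0 := by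
  have : (Matrix.of fun l j : Fin 5 => if (4 : ℕ) = (l : ℕ) + j then (1 : k) else 0) *
      (Matrix.of fun l j : Fin 5 => if (4 : ℕ) = (l : ℕ) + j then (1 : k) else 0) = 1 := by
    ext i j
    fin_cases i <;> fin_cases j <;> simp [Matrix.mul_apply, Fin.sum_univ_five]
  have h2 := congrArg Matrix.det this
  rw [Matrix.det_mul, Matrix.det_one] at h2
  intro h
  rw [h] at h2
  simp at h2

lemma hank_all [Infinite k] (η : Polynomial k →ₗ[k] k) (h : Ind (hank η)) : Good (hank η) := by
  refine semicont (B := hank (Polynomial.lcoeff k 4)) h ?_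
  have hdet := PF.ev (k := k) (c := fun ε => (Matrix.of fun l j : Fin 5 =>
    (Polynomial.lcoeff k 4 + ε • η) (Polynomial.X ^ ((l : ℕ) + j))).det)
    (PF.det fun i j => by
      simp only [Matrix.of_apply, LinearMap.add_apply, LinearMap.smul_apply, smul_eq_mul]
      exact (PF.const _).add (PF.idd.mul (PF.const _)))
    (by
      convert anti_det (k := k) using 3
      ext l j
      simp [Polynomial.coeff_X_pow])
  filter_upwards [hdet] with ε hε
  have := hank_good _ (hank_nondeg _ hε)
  convert this using 1
  funext l
  apply LinearMap.ext
  intro p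
  simp [hank_apply]

/-- the base point -/
def GG (k : Type) [Field k] : Fin 3 → (RR k →ₗ[k] k) := hank (Polynomial.lcoeff k 4)

lemma GG_XX (l : Fin 3) (i j : Fin 4) : GG k l (X i * X j) = if 4 = (l : ℕ) + i + j then 1 else 0 := by
  rw [GG, hank_XX, Polynomial.lcoeff_apply, Polynomial.coeff_X_pow]

lemma GG_ind (A : Fin 3 → (RR k →ₗ[k] k)) :
    ∀ᶠ ε in Filter.cofinite, Ind (fun l => GG k l + (ε : k) • A l) := by
  let r : Fin 3 → RR k := ![X 1 * X 3, X 1 * X 2, X 1 * X 1]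
  have hdet := PF.ev (k := k) (c := fun ε => (Matrix.of fun l m : Fin 3 =>
    (GG k l + ε • A l) (r m)).det)
    (PF.det fun i j => by
      simp only [Matrix.of_apply, LinearMap.add_apply, LinearMap.smul_apply, smul_eq_mul]
      exact (PF.const _).add (PF.idd.mul (PF.const _)))
    (by
      have : (Matrix.of fun l m : Fin 3 => (GG k l + (0 : k) • A l) (r m)) = 1 := by
        ext l m
        fin_cases l <;> fin_cases m <;> simp [r, GG_XX]
      rw [this]; simp)
  filter_upwards [hdet] with ε hε
  refine ⟨r, fun m => ?_, hε⟩
  rw [mem_homogeneousSubmodule]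
  fin_cases m
  · exact (isHomogeneous_X k 1).mul (isHomogeneous_X k 3)
  · exact (isHomogeneous_X k 1).mul (isHomogeneous_X k 2)
  · exact (isHomogeneous_X k 1).mul (isHomogeneous_X k 1)

lemma hankel_of {k : Type} (g : Fin 3 → Fin 4 → Fin 4 → k)
    (h1 : ∀ (l i : Fin 3) j, g l i.castSucc j = g i l.castSucc j)
    (h2 : ∀ (l i : Fin 3) j, g l i.succ j = g i l.succ j)
    (h3 : ∀ l i j, g l i j = g l j i) :
    ∃ h : ℕ → k, ∀ l i j, g l i j = h ((l : ℕ) + i + j) := by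
  have H : ∀ (l : Fin 2) (i : Fin 3) (j : Fin 4), g l.castSucc i.succ j = g l.succ i.castSucc j := by
    intro l i j
    rw [h2, h1 l.succ i j]; rfl
  have a1 : ∀ j, g 0 1 j = g 1 0 j := fun j => H 0 0 j
  have a2 : ∀ j, g 0 2 j = g 1 1 j := fun j => H 0 1 j
  have a3 : ∀ j, g 0 3 j = g 1 2 j := fun j => H 0 2 j
  have b1 : ∀ j, g 1 1 j = g 2 0 j := fun j => H 1 0 j
  have b2 : ∀ j, g 1 2 j = g 2 1 j := fun j => H 1 1 j
  have b3 : ∀ j, g 1 3 j = g 2 2 j := fun j => H 1 2 j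
  refine ⟨fun n => (![g 0 0 0, g 0 0 1, g 0 0 2, g 0 0 3, g 0 1 3, g 0 2 3, g 0 3 3, g 1 3 3, g 2 3 3]
    : Fin 9 → k) (Fin.ofNat 9 n), ?_⟩
  intro l i j
  have c := fun l => h3 l 0 1
  have c2 := fun l => h3 l 0 2
  have c3 := fun l => h3 l 0 3
  have c4 := fun l => h3 l 1 2
  have c5 := fun l => h3 l 1 3
  have c6 := fun l => h3 l 2 3
  fin_cases l <;> fin_cases i <;> fin_cases j <;> simp [Fin.ofNat] <;> grind

/-- `e ν = (ν, 0)` -/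
def ee (ν : Fin 3 → k) : Fin 4 → k := Fin.snoc ν 0

def ww (w : Fin 3 → Fin 4 → k) (ν : Fin 3 → k) : Fin 4 → k := fun j => ∑ i, ν i * w i j

lemma ee_last (ν : Fin 3 → k) : ee ν (Fin.last 3) = 0 := Fin.snoc_last (α := fun _ => k) _ _

lemma ee_cs (ν : Fin 3 → k) (i : Fin 3) : ee ν i.castSucc = ν i := Fin.snoc_castSucc (α := fun _ => k) _ _ _

lemma lf_ee (ν : Fin 3 → k) : lf (ee ν) = ∑ i, ν i • (X i.castSucc : RR k) := by
  rw [lf, Fin.sum_univ_castSucc, ee_last, zero_smul, add_zero]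
  simp only [ee_cs]

lemma lf_ww (w : Fin 3 → Fin 4 → k) (ν : Fin 3 → k) : lf (ww w ν) = ∑ i, ν i • lf (w i) := by
  simp only [lf, ww, Finset.sum_smul, Finset.smul_sum, smul_smul]
  rw [Finset.sum_comm]

def obsM (w : Fin 3 → Fin 4 → k) : Matrix (Fin 3) (Fin 3) k := Matrix.of fun i c =>
  (![w i 3, ∑ j : Fin 3, w i j.castSucc * w j 3,
    ∑ j : Fin 3, w i j.castSucc * ∑ j' : Fin 3, w j j'.castSucc * w j' 3] : Fin 3 → k) c

lemma obs_mu (w : Fin 3 → Fin 4 → k) (h : (obsM w).det ≠ 0) :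
    ∃ μ : Matrix (Fin 3) (Fin 3) k, μ.det ≠ 0 ∧ ww w (μ 1) = ee (μ 0) ∧ ww w (μ 2) = ee (μ 1) ∧
      ww w (μ 0) 3 = 1 := by
  let m : Fin 3 → k := Matrix.vecMul ![0, 0, 1] (obsM w)⁻¹
  have hm : Matrix.vecMul m (obsM w) = ![0, 0, 1] := by
    simp [m, Matrix.vecMul_vecMul, Matrix.nonsing_inv_mul _ (isUnit_iff_ne_zero.2 h)]
  have e0 := congrFun hm 0
  have e1 := congrFun hm 1
  have e2 := congrFun hm 2
  simp [Matrix.vecMul, dotProduct, obsM, Fin.sum_univ_three] at e0 e1 e2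
  let m1 : Fin 3 → k := fun j => ww w m j.castSucc
  let m0 : Fin 3 → k := fun j => ww w m1 j.castSucc
  have f0 : ww w m1 3 = 0 := by
    rw [← e1]; simp [ww, m1, Fin.sum_univ_three]; ring
  have f1 : ww w m0 3 = 1 := by
    rw [← e2]; simp [ww, m1, m0, Fin.sum_univ_three]; ring
  have f2 : ww w m 3 = 0 := by
    rw [← e0]; simp [ww, Fin.sum_univ_three]
  refine ⟨Matrix.of ![m0, m1, m], ?_, ?_, ?_, f1⟩
  · have : (Matrix.of ![m0, m1, m] * obsM w).det = 1 := by
      have g00 : (Matrix.of ![m0, m1, m] * obsM w) 0 0 = 1 := by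
        rw [← f1]; simp [Matrix.mul_apply, obsM, ww]
      have g10 : (Matrix.of ![m0, m1, m] * obsM w) 1 0 = 0 := by
        rw [← f0]; simp [Matrix.mul_apply, obsM, ww]
      have g20 : (Matrix.of ![m0, m1, m] * obsM w) 2 0 = 0 := by
        rw [← f2]; simp [Matrix.mul_apply, obsM, ww]
      have g11 : (Matrix.of ![m0, m1, m] * obsM w) 1 1 = 1 := by
        rw [← f1]; simp [Matrix.mul_apply, obsM, ww, m0, Fin.sum_univ_three]; ring
      have g21 : (Matrix.of ![m0, m1, m] * obsM w) 2 1 = 0 := by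
        rw [← f0]; simp [Matrix.mul_apply, obsM, ww, m1, Fin.sum_univ_three]; ring
      have g22 : (Matrix.of ![m0, m1, m] * obsM w) 2 2 = 1 := by
        rw [← e2]; simp [Matrix.mul_apply, obsM, Fin.sum_univ_three]
      rw [Matrix.det_fin_three, g00, g10, g20, g11, g21, g22]; ring
    rw [Matrix.det_mul] at this
    intro h0
    rw [h0] at this; simp at this
  · ext j
    refine Fin.lastCases ?_ (fun j => ?_) j
    · rw [ee_last]; exact f0
    · rw [ee_cs]; rfl
  · ext j
    refine Fin.lastCases ?_ (fun j => ?_) j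
    · rw [ee_last]; exact f2
    · rw [ee_cs]; rfl

lemma obs_good [Infinite k] (A : Fin 3 → (RR k →ₗ[k] k)) (w : Fin 3 → Fin 4 → k)
    (hs : ∀ (i l : Fin 3) (j : Fin 4), A l (X i.castSucc * X j) = A i (X l.castSucc * X j))
    (hw : ∀ (i l : Fin 3) (j : Fin 4), A l (lf (w i) * X j) = A i (lf (w l) * X j))
    (ho : (obsM w).det ≠ 0) (hI : Ind A) : Good A := by
  obtain ⟨μ, hμ, hw1, hw2, hw0⟩ := obs_mu w ho
  let P : Matrix (Fin 4) (Fin 4) k := Matrix.of (Fin.cons (ww w (μ 0)) fun i => ee (μ i))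
  have Ps : ∀ i : Fin 3, P i.succ = ee (μ i) := fun i => rfl
  have Pc : ∀ i : Fin 3, P i.castSucc = ww w (μ i) := by
    intro i
    fin_cases i
    · rfl
    · exact hw1.symm
    · exact hw2.symm
  have hP : P.det ≠ 0 := by
    intro h0
    obtain ⟨c, hc, hcP⟩ := Matrix.exists_vecMul_eq_zero_iff.2 h0
    have c0 : c 0 = 0 := by
      have := congrFun hcP 3
      simp only [Matrix.vecMul, dotProduct, Fin.sum_univ_succ (n := 3), Ps] at this
      have e : ∀ i, ee (μ i) 3 = 0 := fun i => ee_last _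
      simp only [e] at this
      simpa [P, hw0] using this
    have : (fun i : Fin 3 => c i.succ) = 0 := by
      apply Matrix.eq_zero_of_vecMul_eq_zero hμ
      ext j
      have := congrFun hcP j.castSucc
      simp only [Matrix.vecMul, dotProduct, Fin.sum_univ_succ (n := 3), Ps, c0, ee_cs] at this
      simpa [Matrix.vecMul, dotProduct] using this
    apply hc
    ext i
    refine Fin.cases c0 (fun i => congrFun this i) i
  let At : Fin 3 → (RR k →ₗ[k] k) := fun l => ∑ j, μ l j • A j
  have hle : NN A ≤ NN At := by
    intro p hp
    rw [mem_NN] at hp ⊢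
    exact ⟨hp.1, fun l => by simp [At, hp.2]⟩
  have hIt : Ind At := by
    obtain ⟨r, hr, hd⟩ := hI
    refine ⟨r, hr, ?_⟩
    have : (Matrix.of fun l m => At l (r m)) = μ * (Matrix.of fun l m => A l (r m)) := by
      ext l m
      simp [At, Matrix.mul_apply]
    rw [this, Matrix.det_mul]
    exact mul_ne_zero hμ hd
  refine good_of_le hle ?_
  have hQP : P⁻¹ * P = 1 := Matrix.nonsing_inv_mul _ (isUnit_iff_ne_zero.2 hP)
  refine good_transport (lsub P) (lsub P⁻¹) (lsub_lsub _ _ hQP) (fun p hp => lsub_hom _ _ _ hp) ?_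
  have hI2 := ind_transport (A := At) (lsub P) (lsub P⁻¹) (lsub_lsub _ _ hQP) (fun p hp => lsub_hom _ _ _ hp) hIt
  -- symmetries
  have hs' : ∀ (i l : Fin 3) (b : Fin 4 → k), A l (X i.castSucc * lf b) = A i (X l.castSucc * lf b) := by
    intro i l b
    simp only [lf, Finset.mul_sum, mul_smul_comm, map_sum, map_smul, hs i l]
  have hw' : ∀ (i l : Fin 3) (b : Fin 4 → k), A l (lf (w i) * lf b) = A i (lf (w l) * lf b) := by
    intro i l b
    have e : lf b = ∑ j, b j • (X j : RR k) := rfl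
    simp only [e, Finset.mul_sum, mul_smul_comm, map_sum, map_smul, hw i l]
  have hE : ∀ (ν κ : Fin 3 → k) b, ∑ l, ν l * A l (lf (ee κ) * lf b) = ∑ l, κ l * A l (lf (ee ν) * lf b) := by
    intro ν κ b
    simp only [lf_ee, Finset.sum_mul, smul_mul_assoc, map_sum, map_smul, Finset.mul_sum, smul_eq_mul]
    rw [Finset.sum_comm]
    refine Finset.sum_congr rfl fun i _ => Finset.sum_congr rfl fun l _ => ?_
    rw [hs' i l]; ring
  have hW : ∀ (ν κ : Fin 3 → k) b, ∑ l, ν l * A l (lf (ww w κ) * lf b) = ∑ l, κ l * A l (lf (ww w ν) * lf b) := by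
    intro ν κ b
    simp only [lf_ww, Finset.sum_mul, smul_mul_assoc, map_sum, map_smul, Finset.mul_sum, smul_eq_mul]
    rw [Finset.sum_comm]
    refine Finset.sum_congr rfl fun i _ => Finset.sum_congr rfl fun l _ => ?_
    rw [hw' i l]; ring
  obtain ⟨h, hh⟩ := hankel_of (fun l i j => ∑ m, μ l m * A m (lf (P i) * lf (P j)))
    (fun l i j => by simp only [Pc]; exact hW _ _ _)
    (fun l i j => by simp only [Ps]; exact hE _ _ _)
    (fun l i j => by simp only [mul_comm (lf (P i))])
  let η : Polynomial k →ₗ[k] k := (Polynomial.basisMonomials k).constr k h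
  have hη : ∀ n, η (Polynomial.X ^ n) = h n := by
    intro n
    have := (Polynomial.basisMonomials k).constr_basis k h n
    rw [Polynomial.coe_basisMonomials] at this
    rw [← Polynomial.monomial_one_right_eq_X_pow]
    exact this
  have hag : ∀ l (p : RR k), p.IsHomogeneous 2 → ((At l).comp (lsub P).toLinearMap) p = hank η l p := by
    intro l p hp
    refine quad_ext (fun i j => ?_) hp
    rw [hank_XX, hη, ← hh]
    simp [At, lsub]
  have hIη : Ind (hank η) := by
    obtain ⟨r, hr, hd⟩ := hI2
    refine ⟨r, hr, ?_⟩
    have : (Matrix.of fun l m => hank η l (r m)) = Matrix.of fun l m => ((At l).comp (lsub P).toLinearMap) (r m) := by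
      ext l m
      exact (hag l _ (hr m)).symm
    rw [this]; exact hd
  refine good_of_le ?_ (hank_all η hIη)
  intro p hp
  rw [mem_NN] at hp ⊢
  exact ⟨hp.1, fun l => by rw [← hag l p hp.1]; exact hp.2 l⟩

lemma div_X {ι : Type} (n : ℕ) : ∀ (v : ι → Polynomial k) (i : ι), v i ≠ 0 → (v i).natDegree ≤ n →
    ∃ (m : ℕ) (v' : ι → Polynomial k), v = (Polynomial.X : Polynomial k) ^ m • v' ∧
      ∃ i, (v' i).eval 0 ≠ 0 := by
  induction n with
  | zero =>
    intro v i hi hd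
    refine ⟨0, v, by simp, i, ?_⟩
    rw [Polynomial.eq_C_of_natDegree_le_zero hd] at hi ⊢
    simpa using hi
  | succ n ih =>
    intro v i hi hd
    by_cases h : ∃ i, (v i).eval 0 ≠ 0
    · exact ⟨0, v, by simp, h⟩
    push Not at h
    have : ∀ i, ∃ q, v i = Polynomial.X * q := fun i => by
      have := Polynomial.dvd_iff_isRoot.2 (h i)
      simpa [dvd_def] using this
    choose q hq using this
    have hqi : q i ≠ 0 := by
      intro h0; apply hi; rw [hq, h0, mul_zero]
    obtain ⟨m, v', hv', hh⟩ := ih q i hqi (by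
      rw [hq, Polynomial.natDegree_X_mul hqi] at hd; omega)
    refine ⟨m + 1, v', ?_, hh⟩
    funext j
    rw [hq, hv']
    simp [pow_succ]; ring

abbrev II := {p : Fin 3 × Fin 4 // p ≠ (0, 0)}

/-- skew matrix -/
def KK {S : Type} [CommRing S] (τ : Fin 3 → Fin 4 → Fin 4 → S) : Matrix (Fin 3 × Fin 4) (Fin 3 × Fin 4) S :=
  Matrix.of fun a b => if b.1 = a.1 + 1 then τ (a.1 + 2) a.2 b.2 else
    if b.1 = a.1 + 2 then - τ (a.1 + 1) a.2 b.2 else 0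

lemma KK_skew {S : Type} [CommRing S] (τ : Fin 3 → Fin 4 → Fin 4 → S) (hτ : ∀ l i j, τ l i j = τ l j i)
    (a b) : KK τ b a = - KK τ a b := by
  obtain ⟨a1, a2⟩ := a
  obtain ⟨b1, b2⟩ := b
  simp only [KK, Matrix.of_apply]
  rw [hτ (b1 + 2) b2 a2, hτ (b1 + 1) b2 a2]
  fin_cases a1 <;> fin_cases b1 <;> simp

lemma KK_row {S : Type} [CommRing S] (τ : Fin 3 → Fin 4 → Fin 4 → S)
    (hs : ∀ (i l : Fin 3) (j : Fin 4), τ l i.castSucc j = τ i l.castSucc j) (b) :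
    KK τ (0, 0) b = - KK τ (1, 1) b - KK τ (2, 2) b := by
  obtain ⟨b1, b2⟩ := b
  have h01 : τ 0 1 b2 = τ 1 0 b2 := hs 1 0 b2
  have h02 : τ 0 2 b2 = τ 2 0 b2 := hs 2 0 b2
  have h12 : τ 1 2 b2 = τ 2 1 b2 := hs 2 1 b2
  simp only [KK, Matrix.of_apply]
  have e1 : (1 : Fin 3) + 2 = 0 := rfl
  have e2 : (2 : Fin 3) + 2 = 1 := rfl
  have e3 : (2 : Fin 3) + 1 = 0 := rfl
  have e4 : (1 : Fin 3) + 1 = 2 := rfl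
  fin_cases b1 <;> simp [e1, e2, e3, e4, h01, h02, h12]

lemma KK_det {S : Type} [CommRing S] [IsDomain S] (h2 : (2 : S) ≠ 0) (τ : Fin 3 → Fin 4 → Fin 4 → S)
    (hτ : ∀ l i j, τ l i j = τ l j i) :
    ((KK τ).submatrix (Subtype.val : II → _) Subtype.val).det = 0 := by
  set K := (KK τ).submatrix (Subtype.val : II → _) Subtype.val with hK
  have h1 : K.transpose = -K := by
    ext a b
    exact KK_skew τ hτ _ _
  have h3 : K.det = - K.det := by
    conv_lhs => rw [← Matrix.det_transpose, h1, Matrix.det_neg]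
    have : Fintype.card II = 11 := by decide
    rw [this]; ring
  have : 2 * K.det = 0 := by linear_combination h3
  simpa [h2] using this

lemma kern (h2 : (2 : k) ≠ 0) (τ : Fin 3 → Fin 4 → Fin 4 → Polynomial k)
    (hτ : ∀ l i j, τ l i j = τ l j i)
    (hs : ∀ (i l : Fin 3) (j : Fin 4), τ l i.castSucc j = τ i l.castSucc j) :
    ∃ w : Fin 3 → Fin 4 → Polynomial k, w 0 0 = 0 ∧ (∃ i j, (w i j).eval 0 ≠ 0) ∧
      ∀ i l j, ∑ j', w i j' * τ l j' j = ∑ j', w l j' * τ i j' j := by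
  have hP2 : (2 : Polynomial k) ≠ 0 := by
    intro h
    apply h2
    have := congrArg (Polynomial.eval 0) h
    simpa using this
  obtain ⟨v, hv0, hv⟩ := Matrix.exists_mulVec_eq_zero_iff.2 (KK_det hP2 τ hτ)
  obtain ⟨i0, hi0⟩ := Function.ne_iff.1 hv0
  obtain ⟨m, v', hvv, ⟨i1, hi1⟩⟩ := div_X _ v i0 hi0 le_rfl
  rw [hvv, Matrix.mulVec_smul] at hv
  have hv' := (smul_eq_zero.1 hv).resolve_left (pow_ne_zero _ Polynomial.X_ne_zero)
  let u : Fin 3 × Fin 4 → Polynomial k := fun p => if h : p ≠ (0, 0) then v' ⟨p, h⟩ else 0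
  have hu1 : ∀ a : II, ∑ b, KK τ a.1 b * u b = 0 := by
    intro a
    rw [Fintype.sum_eq_add_sum_subtype_ne _ ((0, 0) : Fin 3 × Fin 4)]
    have := congrFun hv' a
    simp only [Matrix.mulVec, dotProduct, Matrix.submatrix_apply, Pi.zero_apply] at this
    simp only [u]
    rw [dif_neg (by simp), mul_zero, zero_add]
    refine Eq.trans ?_ this
    refine Finset.sum_congr rfl fun b _ => ?_
    rw [dif_pos b.2]
  have hu2 : ∀ a, ∑ b, KK τ a b * u b = 0 := by
    intro a
    by_cases ha : a = (0, 0)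
    · subst ha
      have e1 := hu1 ⟨(1, 1), by decide⟩
      have e2 := hu1 ⟨(2, 2), by decide⟩
      simp only [KK_row τ hs, sub_mul, neg_mul, Finset.sum_sub_distrib, Finset.sum_neg_distrib] at *
      rw [e1, e2]; simp
    · exact hu1 ⟨a, ha⟩
  have key : ∀ (m : Fin 3) j, ∑ j', u (m + 1, j') * τ (m + 2) j' j = ∑ j', u (m + 2, j') * τ (m + 1) j' j := by
    intro m j
    have := hu2 (m, j)
    rw [Fintype.sum_prod_type, Fin.sum_univ_three] at this
    simp only [KK, Matrix.of_apply] at this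
    rw [← sub_eq_zero, ← this, ← Finset.sum_sub_distrib, ← Finset.sum_add_distrib, ← Finset.sum_add_distrib]
    refine Finset.sum_congr rfl fun j' _ => ?_
    have e1 : (1 : Fin 3) + 2 = 0 := rfl
    have e2 : (2 : Fin 3) + 2 = 1 := rfl
    have e3 : (2 : Fin 3) + 1 = 0 := rfl
    have e4 : (1 : Fin 3) + 1 = 2 := rfl
    rw [hτ _ j' j, hτ _ j' j]
    fin_cases m <;> simp [e1, e2, e3, e4] <;> ring
  refine ⟨fun i j => u (i, j), by simp [u], ⟨i1.1.1, i1.1.2, ?_⟩, ?_⟩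
  · simp only [u, Prod.mk.eta]
    rw [dif_pos i1.2]
    exact hi1
  · intro i l j
    have k0 := key 0 j
    have k1 := key 1 j
    have k2 := key 2 j
    fin_cases i <;> fin_cases l
    · rfl
    · exact k2
    · exact k1.symm
    · exact k2.symm
    · rfl
    · exact k0
    · exact k1
    · exact k0.symm
    · rfl

lemma base_obs (w : Fin 3 → Fin 4 → k) (h0 : w 0 0 = 0) (hne : ∃ i j, w i j ≠ 0)
    (h : ∀ i l j, ∑ j', w i j' * GG k l (X j' * X j) = ∑ j', w l j' * GG k i (X j' * X j)) :
    (obsM w).det ≠ 0 := by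
  simp only [GG_XX] at h
  have a0 := h 0 1 0
  have a1 := h 0 1 1
  have a2 := h 0 1 2
  have a3 := h 0 1 3
  have b0 := h 0 2 0
  have b1 := h 0 2 1
  have b2 := h 0 2 2
  have b3 := h 0 2 3
  have c0 := h 1 2 0
  have c1 := h 1 2 1
  have c2 := h 1 2 2
  have c3 := h 1 2 3
  simp [Fin.sum_univ_four] at a0 a1 a2 a3 b0 b1 b2 b3 c0 c1 c2 c3
  have hc : w 0 1 ≠ 0 := by
    intro hc
    obtain ⟨i, j, hij⟩ := hne
    apply hij
    fin_cases i <;> fin_cases j <;> simp <;> grind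
  have d12 : w 1 2 = w 0 1 := by grind
  have d23 : w 2 3 = w 0 1 := by grind
  have d10 : w 1 0 = 0 := by grind
  have d11 : w 1 1 = 0 := by grind
  have d13 : w 1 3 = 0 := by grind
  have d20 : w 2 0 = 0 := by grind
  have d21 : w 2 1 = 0 := by grind
  have d22 : w 2 2 = 0 := by grind
  have d02 : w 0 2 = 0 := by grind
  have d03 : w 0 3 = 0 := by grind
  have : (obsM w).det = - (w 0 1) ^ 6 := by
    rw [Matrix.det_fin_three]
    simp [obsM, Fin.sum_univ_three, d12, d23, d10, d11, d13, d20, d21, d22, d02, d03, h0]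
    ring
  rw [this]
  exact neg_ne_zero.2 (pow_ne_zero _ hc)

lemma core [Infinite k] (h2 : (2 : k) ≠ 0) (A : Fin 3 → (RR k →ₗ[k] k))
    (hs : ∀ (i l : Fin 3) (j : Fin 4), A l (X i.castSucc * X j) = A i (X l.castSucc * X j))
    (hI : Ind A) : Good A := by
  refine semicont (B := GG k) hI ?_
  have hG : ∀ (i l : Fin 3) (j : Fin 4), GG k l (X i.castSucc * X j) = GG k i (X l.castSucc * X j) := by
    intro i l j
    rw [GG_XX, GG_XX]
    simp only [Fin.val_castSucc, add_comm (l : ℕ) (i : ℕ)]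
  obtain ⟨w, hw0, hwne, hw⟩ := kern h2
    (fun l i j => Polynomial.C (GG k l (X i * X j)) + Polynomial.X * Polynomial.C (A l (X i * X j)))
    (fun l i j => by rw [mul_comm (X i)]) (fun i l j => by rw [hG i l, hs i l])
  have hwε : ∀ (ε : k) i l j, (GG k l + ε • A l) (lf (fun j => (w i j).eval ε) * X j) =
      (GG k i + ε • A i) (lf (fun j => (w l j).eval ε) * X j) := by
    intro ε i l j
    have := congrArg (Polynomial.eval ε) (hw i l j)
    simp only [Polynomial.eval_finsetSum, Polynomial.eval_mul, Polynomial.eval_add, Polynomial.eval_C,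
      Polynomial.eval_X] at this
    simpa only [lf, Finset.sum_mul, smul_mul_assoc, map_sum, map_smul, LinearMap.add_apply,
      LinearMap.smul_apply, smul_eq_mul] using this
  have hPF : ∀ i j, PF (fun ε : k => (w i j).eval ε) := fun i j => ⟨w i j, fun ε => by simp⟩
  have hobs := PF.ev (k := k) (c := fun ε => (obsM fun i j => (w i j).eval ε).det)
    (PF.det fun i c => by
      simp only [obsM, Matrix.of_apply]
      fin_cases c
      · exact hPF _ _
      · exact PF.sum Finset.univ fun j : Fin 3 => (hPF i j.castSucc).mul (hPF j 3)
      · exact PF.sum Finset.univ fun j : Fin 3 => (hPF i j.castSucc).mul (PF.sum Finset.univ fun j' : Fin 3 => (hPF j j'.castSucc).mul (hPF j' 3)))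
    (base_obs _ (by simp [hw0]) hwne (fun i l j => by
      have := hwε 0 i l j
      simpa only [lf, Finset.sum_mul, smul_mul_assoc, map_sum, map_smul, zero_smul, add_zero,
        smul_eq_mul] using this))
  filter_upwards [hobs, GG_ind A] with ε h1 h3
  refine obs_good _ _ (fun i l j => ?_) (hwε ε) h1 h3
  simp only [LinearMap.add_apply, LinearMap.smul_apply, hG i l, hs i l]

lemma pd_comm (i j : Fin 4) (p : RR k) : pderiv i (pderiv j p) = pderiv j (pderiv i p) := by
  by_cases h : i = j
  · rw [h]
  ext m
  simp only [coeff_pderiv]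
  have e : m + Finsupp.single i 1 + Finsupp.single j 1 = m + Finsupp.single j 1 + Finsupp.single i 1 :=
    add_right_comm _ _ _
  rw [e]
  simp [h, Ne.symm h]
  ring

/-- apolarity functional -/
def dd (f : RR k) : RR k →ₗ[k] k := (basisMonomials (Fin 4) k).constr k fun m => coeff 0 (monD k m f)

lemma dd_monomial (f : RR k) (m : Fin 4 →₀ ℕ) (c : k) : dd f (monomial m c) = c * coeff 0 (monD k m f) := by
  have h : (monomial m c : RR k) = c • basisMonomials (Fin 4) k m := by
    rw [coe_basisMonomials, smul_monomial, smul_eq_mul, mul_one]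
  rw [h, map_smul, dd, Module.Basis.constr_basis, smul_eq_mul]

lemma dd_apply (f q : RR k) : dd f q = coeff 0 (diffOp q f) := by
  conv_lhs => rw [← support_sum_monomial_coeff q]
  rw [map_sum, diffOp, coeff_sum]
  refine Finset.sum_congr rfl fun m _ => ?_
  rw [dd_monomial, coeff_smul, smul_eq_mul]

lemma mon_two {M : Type} [Monoid M] (D : Fin 4 → M) (hc : ∀ i j, D i * D j = D j * D i) (i j : Fin 4) :
    D 0 ^ ((Finsupp.single i 1 + Finsupp.single j 1 : Fin 4 →₀ ℕ) 0) *
    D 1 ^ ((Finsupp.single i 1 + Finsupp.single j 1 : Fin 4 →₀ ℕ) 1) *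
    D 2 ^ ((Finsupp.single i 1 + Finsupp.single j 1 : Fin 4 →₀ ℕ) 2) *
    D 3 ^ ((Finsupp.single i 1 + Finsupp.single j 1 : Fin 4 →₀ ℕ) 3) = D i * D j := by
  fin_cases i <;> fin_cases j <;> simp [pow_two] <;> exact hc _ _

lemma monD_two (i j : Fin 4) (f : RR k) :
    monD k (Finsupp.single i 1 + Finsupp.single j 1) f = pderiv i (pderiv j f) := by
  have h := mon_two (M := Module.End k (MvPolynomial (Fin 4) k)) (fun i => (pderiv i).toLinearMap)
    (fun i j => LinearMap.ext fun p => pd_comm i j p) i j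
  exact LinearMap.congr_fun h f

lemma dd_XX (f : RR k) (i j : Fin 4) : dd f (X i * X j) = coeff 0 (pderiv i (pderiv j f)) := by
  rw [X, X, monomial_mul, dd_monomial, monD_two]; simp

/-- directional derivative, linear -/
def dirD (v : Fin 4 → k) : RR k →ₗ[k] RR k := ∑ i, v i • (pderiv i).toLinearMap

lemma dirD_apply (v : Fin 4 → k) (F : RR k) : dirD v F = dirDeriv v F := by
  simp [dirD, dirDeriv]

lemma dirD_comm (a b : Fin 4 → k) (F : RR k) : dirD a (dirD b F) = dirD b (dirD a F) := by
  simp only [dirD_apply, dirDeriv, map_sum, map_smul, Finset.smul_sum, smul_smul]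
  rw [Finset.sum_comm]
  refine Finset.sum_congr rfl fun i _ => Finset.sum_congr rfl fun j _ => ?_
  rw [pd_comm, mul_comm]

lemma dd_lf (f : RR k) (a b : Fin 4 → k) : dd f (lf a * lf b) = coeff 0 (dirD a (dirD b f)) := by
  simp only [dirD_apply, dirDeriv, map_sum, map_smul, Finset.smul_sum, smul_smul, lf, Finset.sum_mul,
    Finset.mul_sum, smul_mul_assoc, mul_smul_comm, dd_XX, coeff_sum, coeff_smul, smul_eq_mul, mul_assoc]

lemma quad_zero (h2 : (2 : k) ≠ 0) {g : RR k} (hg : g.IsHomogeneous 2)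
    (h : ∀ i j, coeff 0 (pderiv i (pderiv j g)) = 0) : g = 0 := by
  have e2 : ∀ i j, pderiv i (pderiv j g) = 0 := by
    intro i j
    have h0 : (pderiv i (pderiv j g)).IsHomogeneous 0 := (hg.pderiv (i := j)).pderiv (i := i)
    rw [totalDegree_eq_zero_iff_eq_C.1 (Nat.le_zero.1 h0.totalDegree_le), h, C_0]
  have e1 : ∀ j, pderiv j g = 0 := by
    intro j
    have := (hg.pderiv (i := j)).sum_X_mul_pderiv
    simpa [e2] using this.symm
  have := hg.sum_X_mul_pderiv
  simp only [e1, mul_zero, Finset.sum_const_zero] at this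
  have h3 : (2 : k) • g = 0 := by
    rw [two_smul, ← two_nsmul]; exact this.symm
  exact (smul_eq_zero.1 h3).resolve_left h2

/-- directional derivative of `F`, linear in the vector -/
def DF (F : RR k) : (Fin 4 → k) →ₗ[k] RR k := Fintype.linearCombination k fun i => pderiv i F

lemma DF_apply (F : RR k) (v) : DF F v = dirDeriv v F := by
  simp [DF, dirDeriv, Fintype.linearCombination_apply]

lemma DF_hom {F : RR k} (hF : F.IsHomogeneous 3) (v) : (DF F v).IsHomogeneous 2 := by
  rw [DF_apply, dirDeriv, ← mem_homogeneousSubmodule]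
  exact sum_mem fun i _ => Submodule.smul_mem _ _ hF.pderiv

lemma ind_of (h2 : (2 : k) ≠ 0) (b : Fin 3 → RR k) (hb : ∀ l, (b l).IsHomogeneous 2)
    (hli : LinearIndependent k b) : Ind (fun l => dd (b l)) := by
  have htop : (homogeneousSubmodule (Fin 4) k 2).map (LinearMap.pi fun l => dd (b l)) = ⊤ := by
    by_contra hne
    obtain ⟨f, hf, hle⟩ := Submodule.exists_le_ker_of_lt_top _ (lt_top_iff_ne_top.2 hne)
    have hfs : ∀ x, f x = ∑ l, x l * f (Pi.single l 1) := by
      intro x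
      conv_lhs => rw [← Finset.univ_sum_single x]
      rw [map_sum]
      refine Finset.sum_congr rfl fun l _ => ?_
      have : Pi.single l (x l) = x l • (Pi.single l 1 : Fin 3 → k) := by
        rw [← Pi.single_smul]; simp
      rw [this, map_smul, smul_eq_mul]
    have hg : ∑ l, f (Pi.single l 1) • b l = 0 := by
      refine quad_zero h2 ?_ fun i j => ?_
      · rw [← mem_homogeneousSubmodule]
        exact sum_mem fun i _ => Submodule.smul_mem _ _ (hb i)
      · have hX : (X i * X j : RR k) ∈ homogeneousSubmodule (Fin 4) k 2 :=
          (isHomogeneous_X k i).mul (isHomogeneous_X k j)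
        have := hle (Submodule.mem_map_of_mem hX)
        rw [LinearMap.mem_ker, hfs] at this
        rw [← this]
        rw [map_sum, map_sum, coeff_sum]
        refine Finset.sum_congr rfl fun l _ => ?_
        rw [Derivation.map_smul, Derivation.map_smul, coeff_smul, LinearMap.pi_apply, dd_XX, smul_eq_mul, mul_comm]
    have hc := Fintype.linearIndependent_iff.1 hli _ hg
    apply hf
    apply LinearMap.ext
    intro x
    rw [hfs]
    simp only [hc, mul_zero, Finset.sum_const_zero, LinearMap.zero_apply]
  have : ∀ m : Fin 3, ∃ r ∈ homogeneousSubmodule (Fin 4) k 2, (LinearMap.pi fun l => dd (b l)) r = Pi.single m 1 := by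
    intro m
    have : (Pi.single m 1 : Fin 3 → k) ∈ (homogeneousSubmodule (Fin 4) k 2).map (LinearMap.pi fun l => dd (b l)) := by
      rw [htop]; trivial
    obtain ⟨r, hr, h⟩ := this
    exact ⟨r, hr, h⟩
  choose r hr hh using this
  refine ⟨r, hr, ?_⟩
  have : (Matrix.of fun l m => dd (b l) (r m)) = 1 := by
    ext l m
    have := congrFun (hh m) l
    rw [LinearMap.pi_apply] at this
    rw [Matrix.of_apply, this, Matrix.one_apply, Pi.single_apply]
  rw [this, Matrix.det_one]
  exact one_ne_zero

lemma dd_symm (F : RR k) (a b c : Fin 4 → k) :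
    dd (DF F a) (lf b * lf c) = dd (DF F b) (lf a * lf c) := by
  rw [dd_lf, dd_lf, DF_apply, DF_apply, ← dirD_apply, ← dirD_apply]
  rw [dirD_comm c a, dirD_comm b a, dirD_comm b c]

lemma lsub_XX (P : Matrix (Fin 4) (Fin 4) k) (i j : Fin 4) :
    lsub P (X i * X j) = lf (P i) * lf (P j) := by simp [lsub]

lemma exists_P (v : Fin 3 → Fin 4 → k) (hv : LinearIndependent k v) :
    ∃ P : Matrix (Fin 4) (Fin 4) k, P⁻¹ * P = 1 ∧ ∀ i : Fin 3, P i.castSucc = v i := by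
  obtain ⟨x, hx⟩ : ∃ x, x ∉ Submodule.span k (Set.range v) := by
    by_contra! h
    have h1 : Submodule.span k (Set.range v) = ⊤ := by
      rw [eq_top_iff]; intro x _; exact h x
    have h3 := finrank_span_eq_card hv
    rw [h1, finrank_top] at h3
    simp at h3
  have hP' : LinearIndependent k (Fin.snoc v x : Fin 4 → Fin 4 → k) := linearIndependent_finSnoc.2 ⟨hv, hx⟩
  let P : Matrix (Fin 4) (Fin 4) k := Matrix.of (Fin.snoc v x : Fin 4 → Fin 4 → k)
  have hP : IsUnit P := Matrix.linearIndependent_rows_iff_isUnit.1 hP'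
  exact ⟨P, Matrix.nonsing_inv_mul _ ((Matrix.isUnit_iff_isUnit_det _).1 hP),
    fun i => Fin.snoc_castSucc (α := fun _ => Fin 4 → k) _ _ _⟩

lemma good_main [Infinite k] (h2 : (2 : k) ≠ 0) (F : RR k) (hF : F.IsHomogeneous 3)
    (v : Fin 3 → Fin 4 → k) (hli : LinearIndependent k fun l => DF F (v l)) :
    Good (fun l => dd (DF F (v l))) := by
  have hI : Ind (fun l => dd (DF F (v l))) := ind_of h2 _ (fun l => DF_hom hF _) hli
  have hv : LinearIndependent k v := LinearIndependent.of_comp (DF F) hli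
  obtain ⟨P, hQP, hPv⟩ := exists_P v hv
  refine good_transport (lsub P) (lsub P⁻¹) (lsub_lsub _ _ hQP) (fun p hp => lsub_hom _ _ _ hp) ?_
  have hI2 := ind_transport (lsub P) (lsub P⁻¹) (lsub_lsub _ _ hQP) (fun p hp => lsub_hom _ _ _ hp) hI
  refine core h2 _ (fun i l j => ?_) hI2
  rw [LinearMap.comp_apply, LinearMap.comp_apply, AlgHom.toLinearMap_apply, AlgHom.toLinearMap_apply,
    lsub_XX, lsub_XX, hPv, hPv]
  exact dd_symm F _ _ _

/-- **Schreyerfest-dinner theorem, apolar form.** If `F` is a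
homogeneous cubic in `k[x₀,x₁,x₂,x₃]` and `L` is a 3-dimensional space of
quadratic forms contained in the span of the directional derivatives
`{D_v F : v ∈ k⁴}`, then `dim K(L) ≥ 3`: the projected Veronese `X_L` lies
on an at least three-dimensional space of cubic hypersurfaces in `P⁶`. -/
theorem schreyerfest_dinner
    [IsAlgClosed k] (h2 : (2 : k) ≠ 0) (h3 : (3 : k) ≠ 0)
    (F : MvPolynomial (Fin 4) k) (hF : F.IsHomogeneous 3)
    (L : Submodule k (MvPolynomial (Fin 4) k))
    (hdim : Module.finrank k L = 3)
    (hLF : L ≤ Submodule.span k {p | ∃ v : Fin 4 → k, p = dirDeriv v F})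
    (q : Fin 7 → MvPolynomial (Fin 4) k) (hq : IsPerpBasis L q) :
    3 ≤ Module.finrank k (cubicRelations q) := by
  have hinf : Infinite k := IsAlgClosed.instInfinite
  have : Module.Finite k L := Module.finite_of_finrank_pos (by omega)
  let b := Module.finBasisOfFinrankEq k L hdim
  have hrange : L ≤ LinearMap.range (DF F) := by
    refine hLF.trans (Submodule.span_le.2 ?_)
    rintro p ⟨v, rfl⟩
    exact ⟨v, DF_apply F v⟩
  have hv : ∀ l, ∃ v, DF F v = (b l : MvPolynomial (Fin 4) k) := fun l => hrange (b l).2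
  choose v hv using hv
  have hli : LinearIndependent k fun l => DF F (v l) := by
    simp only [hv]
    exact b.linearIndependent.map' L.subtype (Submodule.ker_subtype _)
  have hgood := good_main h2 F hF v hli
  have hqN : ∀ i, q i ∈ NN (fun l => dd (DF F (v l))) := by
    intro i
    have h1 : q i ∈ perpSet L := by
      rw [← hq.2]; exact Submodule.subset_span ⟨i, rfl⟩
    rw [mem_NN]
    refine ⟨h1.1, fun l => ?_⟩
    rw [dd_apply, hv, h1.2 _ (b l).2, coeff_zero]
  have hmap : (homogeneousSubmodule (Fin 7) k 3).map (aeval q).toLinearMap ≤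
      NN (fun l => dd (DF F (v l))) ^ 3 := by
    rw [← homogeneousSubmodule_one_pow, homogeneousSubmodule_one_eq_span_X, Submodule.map_pow]
    refine subpow_le ?_ 3
    rw [Submodule.map_span, Submodule.span_le]
    rintro _ ⟨_, ⟨i, rfl⟩, rfl⟩
    simpa using hqN i
  have h81 := (Submodule.finrank_mono hmap).trans hgood
  have hrn := rank_null (homogeneousSubmodule (Fin 7) k 3) (aeval q).toLinearMap
  have h84 : Module.finrank k (homogeneousSubmodule (Fin 7) k 3) = 84 := by
    rw [finrank_hom, Nat.multichoose_eq]; decide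
  rw [h84] at hrn
  change _ + Module.finrank k (cubicRelations q) = 84 at hrn
  exact (by omega : ∀ a x : ℕ, a + x = 84 → a ≤ 81 → 3 ≤ x) _ _ hrn h81

end
end

section
/- (Secant lemma.) Let L be a 3-dimensional subspace of the quadratic forms in k[x₀,x₁,x₂,x₃] containing a nonzero quadratic form of rank at most 2 (equivalently, P(L) intersects the second secant variety of the Veronese v₂(P³)). Then dim_k K(L) ≥ 3, i.e. the projected image X_L lies on an at least three-dimensional space of cubic hypersurfaces in P⁶. -/
open MvPolynomial

noncomputable section

variable {k : Type} [Field k]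

theorem finrank_homog (n d : ℕ) : Module.finrank k (homogeneousSubmodule (Fin n) k d) =
    (n + d - 1).choose d := by
  classical
  have e : homogeneousSubmodule (Fin n) k d = restrictSupport k {x | x.degree = d} := by
    ext p
    rw [mem_restrictSupport_iff, mem_homogeneousSubmodule]
    constructor
    · intro h x hx
      have := h (mem_support_iff.mp hx)
      rw [Set.mem_ofPred_eq, ← this, Finsupp.degree_eq_weight_one]; rfl
    · intro h x hx
      have := h (mem_support_iff.mpr hx)
      rw [← this]
      rw [Finsupp.degree_eq_weight_one]; rfl
  rw [e, Module.finrank_eq_nat_card_basis (basisRestrictSupport k _)]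
  have e2 : {x : Fin n →₀ ℕ | x.degree = d} ≃ Sym (Fin n) d :=
    (Equiv.subtypeEquivRight (by intro x; simp [Finsupp.degree_apply, Finsupp.sum])).trans
      (Sym.equivNatSum (Fin n) d).symm
  rw [Nat.card_congr e2, Nat.card_eq_fintype_card, Sym.card_sym_eq_choose]
  simp

instance fin_homog (n d : ℕ) : Module.Finite k (homogeneousSubmodule (Fin n) k d) :=
  Module.Finite.iff_fg.mpr (homogeneousSubmodule_fg _ _ d)

theorem exists_pair {G : Matrix (Fin 4) (Fin 4) k} (hG : G ≠ 0) (hr : G.rank ≤ 2) :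
    ∃ u v : Fin 4 → k, LinearIndependent k ![u, v] ∧
      ∀ j, ∃ a b : k, ∀ i, G i j = a * u i + b * v i := by
  classical
  obtain ⟨i₀, j₀, h0⟩ : ∃ i j, G i j ≠ 0 := by
    by_contra! h
    exact hG (by ext i j; exact h i j)
  set w := G.col j₀ with hw
  have hw0 : w ≠ 0 := fun h => h0 (congrFun h i₀)
  by_cases hc : ∀ j, G.col j ∈ Submodule.span k {w}
  · obtain ⟨y, hy⟩ := exists_linearIndependent_pair_of_one_lt_finrank (R := k)
      (M := Fin 4 → k) (by simp) hw0
    refine ⟨w, y, hy, fun j => ?_⟩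
    obtain ⟨a, ha⟩ := Submodule.mem_span_singleton.mp (hc j)
    refine ⟨a, 0, fun i => ?_⟩
    have := congrFun ha i
    simpa using this.symm
  · push Not at hc
    obtain ⟨j₁, hj⟩ := hc
    have hli : LinearIndependent k ![w, G.col j₁] := by
      rw [LinearIndependent.pair_iff' hw0]
      intro a ha
      exact hj (ha ▸ Submodule.smul_mem _ _ (Submodule.mem_span_singleton_self w))
    refine ⟨w, G.col j₁, hli, fun j => ?_⟩
    have h1 : Submodule.span k (Set.range ![w, G.col j₁]) =
        Submodule.span k (Set.range G.col) := by
      apply Submodule.eq_of_le_of_finrank_le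
      · rw [Submodule.span_le]
        rintro _ ⟨i, rfl⟩
        fin_cases i
        · exact Submodule.subset_span ⟨j₀, rfl⟩
        · exact Submodule.subset_span ⟨j₁, rfl⟩
      · rw [finrank_span_eq_card hli, ← Matrix.rank_eq_finrank_span_cols]
        simpa using hr
    have h2 : G.col j ∈ Submodule.span k (Set.range ![w, G.col j₁]) := by
      rw [h1]; exact Submodule.subset_span ⟨j, rfl⟩
    simp only [Matrix.range_cons, Matrix.range_empty, Set.union_empty, Set.singleton_union] at h2
    obtain ⟨a, b, hab⟩ := Submodule.mem_span_pair.mp h2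
    exact ⟨a, b, fun i => by simpa using (congrFun hab i).symm⟩

theorem exists_dual {u v : Fin 4 → k} (h : LinearIndependent k ![u, v]) :
    ∃ u' v' : Fin 4 → k, ∑ i, u' i * u i = 1 ∧ ∑ i, u' i * v i = 0 ∧
      ∑ i, v' i * u i = 0 ∧ ∑ i, v' i * v i = 1 := by
  classical
  obtain ⟨f, hf⟩ := LinearMap.exists_leftInverse_of_injective
    (Fintype.linearCombination k ![u, v])
    (LinearMap.ker_eq_bot.mpr h.fintypeLinearCombination_injective)
  have key : ∀ x : Fin 4 → k, ∀ l, f x l = ∑ i, f (Pi.single i 1) l * x i := by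
    intro x l
    conv_lhs => rw [← LinearMap.sum_single_apply (fun _ => k) x]
    rw [map_sum, Finset.sum_apply]
    refine Finset.sum_congr rfl fun i _ => ?_
    have : (LinearMap.single k (fun _ : Fin 4 => k) i) (x i) = x i • Pi.single i (1:k) := by
      ext j; simp [Pi.single_apply]
    first
      | rw [this, map_smul]; simp [mul_comm]
      | (have : (Pi.single i (x i) : Fin 4 → k) = x i • Pi.single i (1:k) := by
          ext j; simp [Pi.single_apply]
         rw [this, map_smul]; simp [mul_comm])
  have hu : f u = Pi.single 0 1 := by
    have := LinearMap.congr_fun hf (Pi.single 0 1)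
    simpa [Fintype.linearCombination_apply] using this
  have hv : f v = Pi.single 1 1 := by
    have := LinearMap.congr_fun hf (Pi.single 1 1)
    simpa [Fintype.linearCombination_apply] using this
  refine ⟨fun i => f (Pi.single i 1) 0, fun i => f (Pi.single i 1) 1, ?_, ?_, ?_, ?_⟩
  · rw [← key u 0, hu]; simp
  · rw [← key v 0, hv]; simp
  · rw [← key u 1, hu]; simp
  · rw [← key v 1, hv]; simp

theorem exists_sym {G : Matrix (Fin 4) (Fin 4) k} (hs : ∀ i j, G i j = G j i) {u v u' v' : Fin 4 → k}
    (h11 : ∑ i, u' i * u i = 1) (h12 : ∑ i, u' i * v i = 0)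
    (h21 : ∑ i, v' i * u i = 0) (h22 : ∑ i, v' i * v i = 1)
    (hG : ∀ j, ∃ a b : k, ∀ i, G i j = a * u i + b * v i) :
    ∃ α β γ : k, ∀ i j, G i j = α * (u i * u j) + β * (u i * v j + v i * u j) + γ * (v i * v j) := by
  choose a b hab using hG
  have ha : ∀ j, a j = u j * (∑ i, u' i * a i) + v j * (∑ i, u' i * b i) := by
    intro j
    have e1 : ∑ i, u' i * G i j = a j := by
      simp only [hab, mul_add, Finset.sum_add_distrib, mul_left_comm _ (a j), mul_left_comm _ (b j),
        ← Finset.mul_sum, h11, h12]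
      ring
    rw [← e1, Finset.mul_sum, Finset.mul_sum, ← Finset.sum_add_distrib]
    exact Finset.sum_congr rfl fun i _ => by rw [hs, hab]; ring
  have hb : ∀ j, b j = u j * (∑ i, v' i * a i) + v j * (∑ i, v' i * b i) := by
    intro j
    have e1 : ∑ i, v' i * G i j = b j := by
      simp only [hab, mul_add, Finset.sum_add_distrib, mul_left_comm _ (a j), mul_left_comm _ (b j),
        ← Finset.mul_sum, h21, h22]
      ring
    rw [← e1, Finset.mul_sum, Finset.mul_sum, ← Finset.sum_add_distrib]
    exact Finset.sum_congr rfl fun i _ => by rw [hs, hab]; ring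
  have hβ : ∑ i, v' i * a i = ∑ i, u' i * b i := by
    have : ∑ i, v' i * a i = ∑ i, v' i * (u i * (∑ i, u' i * a i) + v i * (∑ i, u' i * b i)) :=
      Finset.sum_congr rfl fun i _ => by rw [← ha]
    rw [this]
    simp only [mul_add, Finset.sum_add_distrib, ← mul_assoc, ← Finset.sum_mul, h21, h22]
    ring
  refine ⟨∑ i, u' i * a i, ∑ i, u' i * b i, ∑ i, v' i * b i, fun i j => ?_⟩
  rw [hab, ha, hb, hβ]; ring

/-- degree two exponents -/
theorem deg_two (m : Fin 4 →₀ ℕ) (h : m.degree = 2) :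
    ∃ i j, m = Finsupp.single i 1 + Finsupp.single j 1 := by
  have : m ≠ 0 := by rintro rfl; simp at h
  obtain ⟨i, hi⟩ := Finsupp.ne_iff.mp this
  have h1 : Finsupp.single i 1 ≤ m := by
    rw [Finsupp.single_le_iff]; exact Nat.one_le_iff_ne_zero.mpr (by simpa using hi)
  obtain ⟨m', rfl⟩ := exists_add_of_le h1
  simp at h
  have : m'.degree = 1 := by omega
  have : m' ≠ 0 := by rintro rfl; simp at this
  obtain ⟨j, hj⟩ := Finsupp.ne_iff.mp this
  have h1 : Finsupp.single j 1 ≤ m' := by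
    rw [Finsupp.single_le_iff]; exact Nat.one_le_iff_ne_zero.mpr (by simpa using hj)
  obtain ⟨m'', rfl⟩ := exists_add_of_le h1
  simp at h
  have h0 : m''.degree = 0 := by omega
  rw [Finsupp.degree_eq_zero_iff] at h0
  exact ⟨i, j, by rw [h0, add_zero]⟩

theorem coeff_pderiv' {n : ℕ} (i : Fin n) (f : MvPolynomial (Fin n) k) (m : Fin n →₀ ℕ) :
    coeff m (pderiv i f) = coeff (m + Finsupp.single i 1) f * (m i + 1) := by
  classical
  induction f using MvPolynomial.induction_on' with
  | add p q hp hq => simp only [map_add, coeff_add, hp, hq, add_mul]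
  | monomial s a =>
    rw [pderiv_monomial, coeff_monomial, coeff_monomial]
    by_cases h : s = m + Finsupp.single i 1
    · subst h; simp
    · rw [if_neg h, zero_mul]
      split_ifs with h'
      · have : s i = 0 := by
          by_contra hs
          apply h
          rw [← h', tsub_add_cancel_of_le]
          rw [Finsupp.single_le_iff]; omega
        simp [this]
      · rfl

theorem gram_symm (f : MvPolynomial (Fin 4) k) (i j : Fin 4) : gram f i j = gram f j i := by
  simp only [gram, Matrix.of_apply]
  by_cases h : i = j
  · subst h; rfl
  · rw [if_neg h, if_neg (Ne.symm h), add_comm]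

theorem pderiv_gram (h2 : (2 : k) ≠ 0) {f : MvPolynomial (Fin 4) k} (hf : f.IsHomogeneous 2)
    (i j : Fin 4) : pderiv i (pderiv j f) = C (2 * gram f i j) := by
  have h := hf.pderiv (i := j) |>.pderiv (i := i)
  have h0 := totalDegree_eq_zero_iff_eq_C.mp ((totalDegree_zero_iff_isHomogeneous _).mpr h)
  rw [h0, coeff_pderiv', coeff_pderiv']
  congr 1
  simp only [gram, Matrix.of_apply]
  by_cases h : i = j
  · subst h
    rw [if_pos rfl, zero_add, ← Finsupp.single_add]
    simp; ring
  · rw [if_neg h]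
    simp [h]
    field_simp

theorem monD_pair (h2 : (2 : k) ≠ 0) {f : MvPolynomial (Fin 4) k} (hf : f.IsHomogeneous 2)
    (i j : Fin 4) : monD k (Finsupp.single i 1 + Finsupp.single j 1) f = C (2 * gram f i j) := by
  have e := pderiv_gram h2 hf
  have s := gram_symm f
  fin_cases i <;> fin_cases j <;>
    simp [monD, Module.End.mul_apply, pow_succ, Finsupp.single_apply] <;>
    first
      | (rw [e]; simp; done)
      | (rw [e, s]; simp; done)

theorem exists_expand {p : MvPolynomial (Fin 4) k} (hp : p.IsHomogeneous 2) :
    ∃ P : Fin 4 → Fin 4 → k,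
      p = ∑ i, ∑ j, monomial (Finsupp.single i 1 + Finsupp.single j 1) (P i j) := by
  classical
  have hm : ∀ m ∈ p.support, ∃ P : Fin 4 → Fin 4 → k, monomial m (coeff m p) =
      ∑ i, ∑ j, monomial (Finsupp.single i 1 + Finsupp.single j 1) (P i j) := by
    intro m hm
    have : m.degree = 2 := by
      have := hp (mem_support_iff.mp hm)
      rw [← this, Finsupp.degree_eq_weight_one]; rfl
    obtain ⟨a, b, rfl⟩ := deg_two m this
    refine ⟨fun i j => if i = a then (if j = b then coeff (Finsupp.single a 1 + Finsupp.single b 1) p else 0) else 0, ?_⟩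
    rw [Finset.sum_eq_single a, Finset.sum_eq_single b] <;> simp +contextual
  choose! P hP using hm
  refine ⟨fun i j => ∑ m ∈ p.support, P m i j, ?_⟩
  conv_lhs => rw [p.as_sum]
  rw [Finset.sum_congr rfl hP, Finset.sum_comm]
  refine Finset.sum_congr rfl fun i _ => ?_
  rw [Finset.sum_comm]
  refine Finset.sum_congr rfl fun j _ => ?_
  rw [map_sum]

theorem diffOp_linear (f : MvPolynomial (Fin 4) k) : ∃ D : MvPolynomial (Fin 4) k →ₗ[k]
    MvPolynomial (Fin 4) k, (∀ p, diffOp p f = D p) ∧ ∀ m c, D (monomial m c) = c • monD k m f := by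
  have hD : ∀ m c, ((basisMonomials (Fin 4) k).constr k (fun m => monD k m f)) (monomial m c) =
      c • monD k m f := by
    intro m c
    have : monomial m c = c • (basisMonomials (Fin 4) k) m := by
      rw [coe_basisMonomials]; simp [smul_monomial]
    rw [this, map_smul, Module.Basis.constr_basis]
  refine ⟨(basisMonomials (Fin 4) k).constr k (fun m => monD k m f), fun p => ?_, hD⟩
  conv_rhs => rw [p.as_sum]
  rw [map_sum, diffOp]
  exact Finset.sum_congr rfl fun m _ => (hD _ _).symm

def restr (u v : Fin 4 → k) : MvPolynomial (Fin 4) k →ₐ[k] MvPolynomial (Fin 2) k :=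
  aeval fun i => C (u i) * X 0 + C (v i) * X 1

theorem restr_eq (h2 : (2 : k) ≠ 0) {p f : MvPolynomial (Fin 4) k} (hp : p.IsHomogeneous 2)
    (hf : f.IsHomogeneous 2) (h : diffOp p f = 0) {u v : Fin 4 → k} {α β γ : k}
    (hG : ∀ i j, gram f i j =
      α * (u i * u j) + β * (u i * v j + v i * u j) + γ * (v i * v j)) :
    ∃ A B D : k, α * A + β * B + γ * D = 0 ∧
      restr u v p = A • (X 0 * X 0) + B • (X 0 * X 1) + D • (X 1 * X 1) := by
  obtain ⟨P, hP⟩ := exists_expand hp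
  refine ⟨∑ i, ∑ j, P i j * (u i * u j), ∑ i, ∑ j, P i j * (u i * v j + v i * u j),
    ∑ i, ∑ j, P i j * (v i * v j), ?_, ?_⟩
  · obtain ⟨D, hD, hD'⟩ := diffOp_linear f
    rw [hD, hP] at h
    simp only [map_sum, hD', monD_pair h2 hf, smul_eq_C_mul, ← C_mul] at h
    simp only [← map_sum] at h
    rw [map_eq_zero_iff _ (C_injective _ _)] at h
    have h' : 2 * ∑ i, ∑ j, P i j * gram f i j = 0 := by
      rw [← h]; simp only [Finset.mul_sum]
      exact Finset.sum_congr rfl fun i _ => Finset.sum_congr rfl fun j _ => by ring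
    rw [← (mul_eq_zero.mp h').resolve_left h2]
    simp only [Finset.mul_sum, ← Finset.sum_add_distrib]
    exact Finset.sum_congr rfl fun i _ => Finset.sum_congr rfl fun j _ => by rw [hG]; ring
  · rw [hP]
    simp only [map_sum, Finset.sum_smul, ← Finset.sum_add_distrib]
    refine Finset.sum_congr rfl fun i _ => Finset.sum_congr rfl fun j _ => ?_
    have : monomial (Finsupp.single i 1 + Finsupp.single j 1) (P i j) = C (P i j) * (X i * X j) := by
      rw [X, X, monomial_mul, C_mul_monomial]; simp
    rw [this]
    simp only [restr, map_mul, aeval_X, aeval_C, smul_eq_C_mul, algebraMap_eq, C_add, C_mul]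
    ring

theorem exists_two_s4 {α β γ : k} (h : ¬ (α = 0 ∧ β = 0 ∧ γ = 0)) {M : Type*} [AddCommGroup M]
    [Module k M] (x y z : M) :
    ∃ e f : M, ∀ A B D : k, α * A + β * B + γ * D = 0 →
      ∃ c d : k, A • x + B • y + D • z = c • e + d • f := by
  by_cases ha : α = 0
  · by_cases hb : β = 0
    · have hc : γ ≠ 0 := fun hc => h ⟨ha, hb, hc⟩
      refine ⟨x, y, fun A B D e => ⟨A, B, ?_⟩⟩
      have : D = 0 := by simpa [ha, hb, hc] using e
      simp [this]
    · refine ⟨x, z - (γ / β) • y, fun A B D e => ⟨A, D, ?_⟩⟩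
      have : B = - (γ / β) * D := by
        field_simp; subst ha; linear_combination e
      subst this
      module
  · refine ⟨y - (β / α) • x, z - (γ / α) • x, fun A B D e => ⟨B, D, ?_⟩⟩
    have : A = - (β / α) * B - (γ / α) * D := by
      field_simp; linear_combination e
    subst this
    module

theorem gram_ne_zero (h2 : (2 : k) ≠ 0) {f : MvPolynomial (Fin 4) k} (hf : f.IsHomogeneous 2)
    (h0 : f ≠ 0) : gram f ≠ 0 := by
  intro h
  apply h0
  ext m
  by_contra hm
  have : m.degree = 2 := by
    have := hf hm
    rw [← this, Finsupp.degree_eq_weight_one]; rfl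
  obtain ⟨a, b, rfl⟩ := deg_two m this
  have := congrFun (congrFun h a) b
  simp only [gram, Matrix.of_apply] at this
  by_cases hab : a = b
  · subst hab
    rw [if_pos rfl] at this
    rw [← Finsupp.single_add] at hm
    exact hm (by simpa using this)
  · rw [if_neg hab] at this
    exact hm (by simpa [h2] using this)

theorem range_bound {V W U : Type*} [AddCommGroup V] [AddCommGroup W] [AddCommGroup U]
    [Module k V] [Module k W] [Module k U] [Module.Finite k W]
    (T : V →ₗ[k] W) (R : W →ₗ[k] U) : Module.finrank k (LinearMap.range T) ≤
      Module.finrank k (LinearMap.range (R.comp T)) + Module.finrank k (LinearMap.ker R) := by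
  let R' : LinearMap.range T →ₗ[k] U := R.comp (LinearMap.range T).subtype
  have h1 := LinearMap.finrank_range_add_finrank_ker R'
  have h2 : LinearMap.range R' = LinearMap.range (R.comp T) := by
    rw [LinearMap.range_comp, LinearMap.range_comp, Submodule.range_subtype]
  have h3 : Module.finrank k (LinearMap.ker R') ≤ Module.finrank k (LinearMap.ker R) := by
    rw [← Submodule.finrank_map_subtype_eq]
    apply Submodule.finrank_mono
    rintro _ ⟨x, hx, rfl⟩
    exact hx
  rw [h2] at h1
  omega

theorem dim_count (q : Fin 7 → MvPolynomial (Fin 4) k) (hq : ∀ i, (q i).IsHomogeneous 2)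
    {u v u' v' : Fin 4 → k}
    (h11 : ∑ i, u' i * u i = 1) (h12 : ∑ i, u' i * v i = 0)
    (h21 : ∑ i, v' i * u i = 0) (h22 : ∑ i, v' i * v i = 1)
    (e f : MvPolynomial (Fin 2) k) (hc : ∀ i, ∃ c d : k, restr u v (q i) = c • e + d • f) :
    3 ≤ Module.finrank k (cubicRelations q) := by
  choose c d hcd using hc
  let T : homogeneousSubmodule (Fin 7) k 3 →ₗ[k] homogeneousSubmodule (Fin 4) k 6 :=
    (aeval q).toLinearMap.restrict (fun x hx => IsHomogeneous.aeval hx q hq)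
  have hlin : ∀ i, (C (u i) * X 0 + C (v i) * X 1 : MvPolynomial (Fin 2) k).IsHomogeneous 1 :=
    fun i => ((isHomogeneous_X k 0).C_mul _).add ((isHomogeneous_X k 1).C_mul _)
  let R : homogeneousSubmodule (Fin 4) k 6 →ₗ[k] homogeneousSubmodule (Fin 2) k 6 :=
    (restr u v).toLinearMap.restrict (fun x hx => by
      have := IsHomogeneous.aeval hx _ hlin
      rw [one_mul] at this
      exact this)
  let g : Fin 7 → MvPolynomial (Fin 2) k := fun i => C (c i) * X 0 + C (d i) * X 1
  let N : homogeneousSubmodule (Fin 7) k 3 →ₗ[k] homogeneousSubmodule (Fin 2) k 3 :=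
    (aeval g).toLinearMap.restrict (fun x hx => by
      have := IsHomogeneous.aeval hx g
        (fun i => ((isHomogeneous_X k 0).C_mul _).add ((isHomogeneous_X k 1).C_mul _))
      simpa using this)
  have hR : Function.Surjective R := by
    rintro ⟨y, hy⟩
    let s : Fin 2 → MvPolynomial (Fin 4) k := ![∑ i, C (u' i) * X i, ∑ i, C (v' i) * X i]
    have hs : ∀ l, (s l).IsHomogeneous 1 := by
      intro l
      fin_cases l
      · exact IsHomogeneous.sum Finset.univ (fun i => C (u' i) * X i) 1
          fun i _ => (isHomogeneous_X k i).C_mul _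
      · exact IsHomogeneous.sum Finset.univ (fun i => C (v' i) * X i) 1
          fun i _ => (isHomogeneous_X k i).C_mul _
    have hs' : ((restr u v).comp (aeval s)) = AlgHom.id k _ := by
      apply MvPolynomial.algHom_ext
      have gen : ∀ w : Fin 4 → k, ∑ i, C (w i) * (C (u i) * X 0 + C (v i) * X 1) =
          C (∑ i, w i * u i) * X (0 : Fin 2) + C (∑ i, w i * v i) * X 1 := by
        intro w
        simp only [map_sum, Finset.sum_mul, ← Finset.sum_add_distrib, C_mul]
        exact Finset.sum_congr rfl fun i _ => by ring
      intro l
      fin_cases l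
      · simp [s, restr, algebraMap_eq, gen, h11, h12]
      · simp [s, restr, algebraMap_eq, gen, h21, h22]
    refine ⟨⟨aeval s y, by simpa using IsHomogeneous.aeval hy s hs⟩, ?_⟩
    apply Subtype.ext
    exact AlgHom.congr_fun hs' y
  have hker : Module.finrank k (LinearMap.ker R) = 77 := by
    have := LinearMap.finrank_range_add_finrank_ker R
    rw [LinearMap.range_eq_top.mpr hR, finrank_top, finrank_homog, finrank_homog] at this
    norm_num [Nat.choose] at this
    omega
  have hcomp : (restr u v).comp (aeval q) = (aeval ![e, f]).comp (aeval g) := by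
    apply MvPolynomial.algHom_ext
    intro i
    simp [hcd, g, smul_eq_C_mul, algebraMap_eq]
  have hRT : Module.finrank k (LinearMap.range (R.comp T)) ≤ 4 := by
    have h1 : LinearMap.ker N ≤ LinearMap.ker (R.comp T) := by
      intro x hx
      have hx' : aeval g x.1 = 0 := congrArg Subtype.val hx
      apply Subtype.ext
      have := AlgHom.congr_fun hcomp x.1
      simp only [AlgHom.comp_apply, hx', map_zero] at this
      exact this
    have h2 := Submodule.finrank_mono h1
    have h3 := LinearMap.finrank_range_add_finrank_ker N
    have h4 := LinearMap.finrank_range_add_finrank_ker (R.comp T)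
    have h5 := Submodule.finrank_le (LinearMap.range N)
    rw [finrank_homog] at h5
    norm_num [Nat.choose] at h5
    omega
  have hT : Module.finrank k (LinearMap.range T) ≤ 81 := by
    have := range_bound T R
    omega
  have hK : 3 ≤ Module.finrank k (LinearMap.ker T) := by
    have := LinearMap.finrank_range_add_finrank_ker T
    rw [finrank_homog] at this
    norm_num [Nat.choose] at this
    omega
  have hfin : Module.Finite k (cubicRelations q) :=
    Submodule.finiteDimensional_of_le (inf_le_left : cubicRelations q ≤ homogeneousSubmodule _ k 3)
  refine hK.trans ?_
  rw [← Submodule.finrank_map_subtype_eq]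
  apply Submodule.finrank_mono
  rintro _ ⟨x, hx, rfl⟩
  exact ⟨x.2, congrArg Subtype.val hx⟩


/-- **secant lemma.** If a 3-dimensional space `L` of quadratic
forms in `k[x₀,x₁,x₂,x₃]` contains a nonzero quadratic form of rank at most 2
(i.e. `P(L)` meets the second secant variety of `v₂(P³)`), then
`dim K(L) ≥ 3`: the projected Veronese `X_L` lies on an at least
three-dimensional space of cubic hypersurfaces in `P⁶`. -/
theorem secant_lemma
    [IsAlgClosed k] (h2 : (2 : k) ≠ 0) (h3 : (3 : k) ≠ 0)
    (L : Submodule k (MvPolynomial (Fin 4) k))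
    (hquad : L ≤ homogeneousSubmodule (Fin 4) k 2)
    (hdim : Module.finrank k L = 3)
    (hsec : ∃ q ∈ L, q ≠ 0 ∧ (gram q).rank ≤ 2)
    (q : Fin 7 → MvPolynomial (Fin 4) k) (hq : IsPerpBasis L q) :
    3 ≤ Module.finrank k (cubicRelations q) := by
  obtain ⟨f, hfL, hf0, hr⟩ := hsec
  have hf : f.IsHomogeneous 2 := hquad hfL
  obtain ⟨u, v, huv, hG⟩ := exists_pair (gram_ne_zero h2 hf hf0) hr
  obtain ⟨u', v', h11, h12, h21, h22⟩ := exists_dual huv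
  obtain ⟨α, β, γ, hS⟩ := exists_sym (gram_symm f) h11 h12 h21 h22 hG
  have hne : ¬ (α = 0 ∧ β = 0 ∧ γ = 0) := by
    rintro ⟨rfl, rfl, rfl⟩
    apply gram_ne_zero h2 hf hf0
    ext i j
    simp [hS]
  have hmem : ∀ i, q i ∈ perpSet L := fun i => hq.2 ▸ Submodule.subset_span ⟨i, rfl⟩
  obtain ⟨e, g, heg⟩ := exists_two_s4 hne (M := MvPolynomial (Fin 2) k) (X 0 * X 0) (X 0 * X 1) (X 1 * X 1)
  refine dim_count q (fun i => (hmem i).1) h11 h12 h21 h22 e g fun i => ?_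
  obtain ⟨A, B, D, h, h'⟩ := restr_eq h2 (hmem i).1 hf ((hmem i).2 f hfL) hS
  rw [h']
  exact heg A B D h

end
end

section
/- Let W be the set of homogeneous degree-2 polynomials in k[x₀,x₁,x₂,x₃] whose coefficient of the monomial x₀x₁ is zero (a 9-dimensional subspace of the quadrics). Then the k-linear span of all triple products {q₁q₂q₃ : q₁,q₂,q₃ ∈ W} has dimension at most 81, i.e. codimension at least 3 in the 84-dimensional space of homogeneous degree-6 polynomials in k[x₀,x₁,x₂,x₃]. -/
open MvPolynomial

/-- The set `W` of homogeneous degree-2 polynomials in `k[x₀,x₁,x₂,x₃]` whose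
coefficient of the monomial `x₀x₁` is zero. -/
def Wset (k : Type) [Field k] : Set (MvPolynomial (Fin 4) k) :=
  {q | q.IsHomogeneous 2 ∧ coeff (Finsupp.single 0 1 + Finsupp.single 1 1) q = 0}

def EvP {k : Type} [Field k] (q : MvPolynomial (Fin 4) k) : Prop :=
  ∀ d : Fin 4 →₀ ℕ, coeff d q ≠ 0 → d 2 = 0 → d 3 = 0 → Even (d 0)

lemma EvP.mul {k : Type} [Field k] {p q : MvPolynomial (Fin 4) k} (hp : EvP p) (hq : EvP q) :
    EvP (p * q) := by
  intro d hd h2 h3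
  rw [coeff_mul] at hd
  obtain ⟨⟨a, b⟩, hab, hne⟩ := Finset.exists_ne_zero_of_sum_ne_zero hd
  rw [Finset.HasAntidiagonal.mem_antidiagonal] at hab
  simp only at hab hne
  subst hab
  simp only [Finsupp.add_apply] at h2 h3 ⊢
  exact (hp a (left_ne_zero_of_mul hne) (by omega) (by omega)).add
    (hq b (right_ne_zero_of_mul hne) (by omega) (by omega))

lemma hom_sum {k : Type} [Field k] {q : MvPolynomial (Fin 4) k} {n : ℕ} (h : q.IsHomogeneous n)
    {d : Fin 4 →₀ ℕ} (hd : coeff d q ≠ 0) : d 0 + d 1 + d 2 + d 3 = n := by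
  have h1 : d.degree = n := by
    by_contra hc
    exact hd (h.coeff_eq_zero hc)
  rw [Finsupp.degree_eq_sum, Fin.sum_univ_four] at h1
  exact h1

lemma evP_of_mem {k : Type} [Field k] {q : MvPolynomial (Fin 4) k} (h : q ∈ Wset k) : EvP q := by
  intro d hd h2 h3
  have hs := hom_sum h.1 hd
  by_contra hodd
  rw [Nat.not_even_iff_odd] at hodd
  obtain ⟨m, hm⟩ := hodd
  apply hd
  have : d = Finsupp.single 0 1 + Finsupp.single 1 1 := by
    ext i
    fin_cases i <;> simp <;> omega
  rw [this]
  exact h.2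

def expSet : Finset (Fin 4 → ℕ) :=
  (Finset.piAntidiag Finset.univ 6).filter (fun f => f 2 = 0 → f 3 = 0 → Even (f 0))

/-- an explicit finite set of size 81 containing the exponents, through the first three entries -/
def expSet3 : Finset (ℕ × ℕ × ℕ) :=
  (Finset.range 7 ×ˢ Finset.range 7 ×ˢ Finset.range 7).filter
    (fun f => f.1 + f.2.1 + f.2.2 ≤ 6 ∧ (f.2.2 = 0 → f.1 + f.2.1 = 6 → f.1 % 2 = 0))

lemma expSet3_card : expSet3.card = 81 := by decide +kernel

lemma expSet_card : expSet.card ≤ 81 := by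
  rw [← expSet3_card]
  apply Finset.card_le_card_of_injOn (fun f => (f 0, f 1, f 2))
  · intro f hf
    simp only [expSet, Finset.coe_filter, Finset.mem_piAntidiag, Fin.sum_univ_four,
      Set.mem_ofPred_eq, Nat.even_iff] at hf
    simp only [expSet3, Finset.coe_filter, Finset.mem_product, Finset.mem_range, Set.mem_ofPred_eq]
    obtain ⟨⟨h1, -⟩, h2⟩ := hf
    refine ⟨⟨by omega, by omega, by omega⟩, by omega, fun h h' => h2 h (by omega)⟩
  · intro f hf g hg hfg
    simp only [expSet, Finset.coe_filter, Finset.mem_piAntidiag, Fin.sum_univ_four,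
      Set.mem_ofPred_eq] at hf hg
    simp only [Prod.mk.injEq] at hfg
    obtain ⟨a, b, c⟩ := hfg
    have := hf.1.1
    have := hg.1.1
    ext i
    fin_cases i <;> simp <;> omega

/-- The `k`-linear span of all triple products `q₁q₂q₃` with
`q₁, q₂, q₃ ∈ W` has dimension at most `81`, i.e. codimension at least `3` in
the 84-dimensional space of homogeneous sextics in `k[x₀,x₁,x₂,x₃]`. -/
theorem span_triple_products_rank_le {k : Type} [Field k] :
    Module.rank k
      (Submodule.span k
        {p : MvPolynomial (Fin 4) k |
          ∃ q₁ ∈ Wset k, ∃ q₂ ∈ Wset k, ∃ q₃ ∈ Wset k, p = q₁ * q₂ * q₃}) ≤ 81 := by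
  classical
  let S : Finset (MvPolynomial (Fin 4) k) :=
    expSet.image (fun f => monomial (Finsupp.equivFunOnFinite.symm f) (1 : k))
  have hle : Submodule.span k
        {p : MvPolynomial (Fin 4) k |
          ∃ q₁ ∈ Wset k, ∃ q₂ ∈ Wset k, ∃ q₃ ∈ Wset k, p = q₁ * q₂ * q₃}
      ≤ Submodule.span k (S : Set (MvPolynomial (Fin 4) k)) := by
    rw [Submodule.span_le]
    rintro p ⟨q₁, h₁, q₂, h₂, q₃, h₃, rfl⟩
    have hE : EvP (q₁ * q₂ * q₃) := ((evP_of_mem h₁).mul (evP_of_mem h₂)).mul (evP_of_mem h₃)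
    have hH : (q₁ * q₂ * q₃).IsHomogeneous 6 := (h₁.1.mul h₂.1).mul h₃.1
    generalize q₁ * q₂ * q₃ = p at hE hH
    rw [SetLike.mem_coe, p.as_sum]
    refine Submodule.sum_mem _ fun d hd => ?_
    rw [mem_support_iff] at hd
    have : monomial d (coeff d p) = coeff d p • monomial d (1 : k) := by
      rw [smul_monomial, smul_eq_mul, mul_one]
    rw [this]
    refine Submodule.smul_mem _ _ (Submodule.subset_span ?_)
    rw [Finset.mem_coe, Finset.mem_image]
    refine ⟨d, ?_, by rw [Finsupp.equivFunOnFinite_symm_coe]⟩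
    simp only [expSet, Finset.mem_filter, Finset.mem_piAntidiag, Fin.sum_univ_four]
    exact ⟨⟨hom_sum hH hd, fun _ _ => Finset.mem_univ _⟩, hE d hd⟩
  calc _ ≤ _ := Submodule.rank_mono hle
    _ ≤ (S.card : Cardinal) := rank_span_finset_le S
    _ ≤ 81 := by exact_mod_cast Finset.card_image_le.trans expSet_card
end

section
/- There exists a 3-dimensional subspace L of the quadratic forms in k[x₀,x₁,x₂,x₃] such that: (i) L = span_k(D_{v₁}F, D_{v₂}F, D_{v₃}F) for some homogeneous cubic F and vectors v₁,v₂,v₃ ∈ k⁴; (ii) L contains no nonzero quadratic form of rank at most 2; and (iii) dim_k K(L) = 3 exactly. In particular, for a general L in the smoothable divisor the space of cubics containing the projected Veronese X_L is exactly three-dimensional. -/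
open MvPolynomial

noncomputable section

variable {k : Type} [Field k]

/-- The seven quadrics spanning `L^⊥`. -/
def Qv {R : Type*} [CommRing R] (x y z w : R) : Fin 7 → R :=
  ![x * y, y * w, z ^ 2, z * w, x ^ 2 - y * z, x * w - y ^ 2, x * z - w ^ 2]

/-- A cubic form, given by a list of integer coefficients and index triples, evaluated at `g`. -/
def cub {R : Type*} [CommRing R] (g : Fin 7 → R) : List (ℤ × Fin 7 × Fin 7 × Fin 7) → R
  | [] => 0
  | p :: t => (p.1 : R) * (g p.2.1 * g p.2.2.1 * g p.2.2.2) + cub g t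

set_option maxHeartbeats 4000000 in
theorem mono_mem {R : Type*} [CommRing R] (x y z w : R) (W : AddSubgroup R)
    (hW : ∀ l, cub (Qv x y z w) l ∈ W)
    (h1 : x ^ 5 * y ∈ W) (h2 : x ^ 5 * z ∈ W) (h3 : x ^ 4 * y * z ∈ W)
    (i j l n : ℕ) (hs : i + j + l + n = 6) :
    x ^ i * y ^ j * z ^ l * w ^ n ∈ W := by
  have K : ∀ (t : List (ℤ × Fin 7 × Fin 7 × Fin 7)) (e₁ e₂ e₃ : ℤ) {m : R},
      m = cub (Qv x y z w) t + (e₁ * (x ^ 5 * y) + e₂ * (x ^ 5 * z) + e₃ * (x ^ 4 * y * z)) →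
      m ∈ W := by
    rintro t e₁ e₂ e₃ m rfl
    refine W.add_mem (hW t) (W.add_mem (W.add_mem ?_ ?_) ?_) <;> rw [← zsmul_eq_mul] <;>
      exact W.zsmul_mem (by assumption) _
  have q : Qv x y z w 0 = x * y ∧ Qv x y z w 1 = y * w ∧ Qv x y z w 2 = z ^ 2 ∧
      Qv x y z w 3 = z * w ∧ Qv x y z w 4 = x ^ 2 - y * z ∧ Qv x y z w 5 = x * w - y ^ 2 ∧
      Qv x y z w 6 = x * z - w ^ 2 := ⟨rfl, rfl, rfl, rfl, rfl, rfl, rfl⟩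
  have h6000 : x ^ 6 * y ^ 0 * z ^ 0 * w ^ 0 ∈ W :=
    K [(1, 4, 4, 4), (-1, 0, 0, 2), (1, 2, 4, 5), (-1, 3, 4, 6), (1, 1, 4, 5), (1, 0, 4, 6), (1, 0, 0, 1), (-1, 3, 5, 5), (-2, 0, 1, 3), (1, 1, 3, 3)] 0 0 2 (by simp only [cub, q]; push_cast; ring)
  have h5100 : x ^ 5 * y ^ 1 * z ^ 0 * w ^ 0 ∈ W :=
    K [] 1 0 0 (by simp only [cub, q]; push_cast; ring)
  have h5010 : x ^ 5 * y ^ 0 * z ^ 1 * w ^ 0 ∈ W :=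
    K [] 0 1 0 (by simp only [cub, q]; push_cast; ring)
  have h5001 : x ^ 5 * y ^ 0 * z ^ 0 * w ^ 1 ∈ W :=
    K [(1, 4, 4, 5), (-1, 1, 4, 6), (1, 0, 5, 6), (1, 0, 0, 4), (-1, 0, 1, 1), (1, 1, 1, 3), (2, 0, 3, 4), (1, 2, 5, 5), (-1, 3, 3, 4), (-1, 1, 2, 3), (2, 0, 1, 2)] 0 0 0 (by simp only [cub, q]; push_cast; ring)
  have h4200 : x ^ 4 * y ^ 2 * z ^ 0 * w ^ 0 ∈ W :=
    K [(1, 1, 4, 6), (-1, 0, 5, 6), (1, 0, 0, 4), (1, 0, 1, 1), (1, 0, 1, 2), (-1, 1, 1, 3)] 0 0 0 (by simp only [cub, q]; push_cast; ring)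
  have h4110 : x ^ 4 * y ^ 1 * z ^ 1 * w ^ 0 ∈ W :=
    K [] 0 0 1 (by simp only [cub, q]; push_cast; ring)
  have h4101 : x ^ 4 * y ^ 1 * z ^ 0 * w ^ 1 ∈ W :=
    K [(1, 1, 4, 4), (2, 0, 0, 3), (1, 1, 2, 5), (-1, 0, 3, 3)] 0 0 0 (by simp only [cub, q]; push_cast; ring)
  have h4020 : x ^ 4 * y ^ 0 * z ^ 2 * w ^ 0 ∈ W :=
    K [(1, 2, 4, 4), (2, 0, 2, 6), (2, 0, 3, 3), (1, 2, 2, 5), (-1, 2, 3, 6), (-1, 3, 3, 3)] 0 0 0 (by simp only [cub, q]; push_cast; ring)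
  have h4011 : x ^ 4 * y ^ 0 * z ^ 1 * w ^ 1 ∈ W :=
    K [(1, 3, 4, 4), (2, 1, 3, 5), (2, 0, 3, 6), (-2, 1, 1, 4), (-2, 0, 0, 6), (-1, 0, 4, 4), (-1, 0, 2, 5), (1, 1, 2, 4)] 1 0 0 (by simp only [cub, q]; push_cast; ring)
  have h4002 : x ^ 4 * y ^ 0 * z ^ 0 * w ^ 2 ∈ W :=
    K [(-1, 4, 4, 6), (-1, 1, 5, 6), (1, 0, 3, 5), (-1, 0, 6, 6), (1, 1, 1, 1), (-1, 0, 2, 4), (-1, 1, 1, 2)] 0 1 0 (by simp only [cub, q]; push_cast; ring)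
  have h3300 : x ^ 3 * y ^ 3 * z ^ 0 * w ^ 0 ∈ W :=
    K [(1, 0, 0, 0)] 0 0 0 (by simp only [cub, q]; push_cast; ring)
  have h3210 : x ^ 3 * y ^ 2 * z ^ 1 * w ^ 0 ∈ W :=
    K [(-1, 0, 4, 4), (-1, 0, 2, 5), (1, 1, 3, 5), (1, 0, 3, 6), (-1, 1, 1, 4), (-1, 0, 0, 6)] 1 0 0 (by simp only [cub, q]; push_cast; ring)
  have h3201 : x ^ 3 * y ^ 2 * z ^ 0 * w ^ 1 ∈ W :=
    K [(1, 1, 3, 4), (-1, 0, 3, 5), (1, 0, 1, 4), (1, 1, 1, 2)] 0 0 0 (by simp only [cub, q]; push_cast; ring)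
  have h3120 : x ^ 3 * y ^ 1 * z ^ 2 * w ^ 0 ∈ W :=
    K [(1, 1, 5, 6), (-1, 0, 3, 5), (1, 0, 6, 6), (2, 1, 3, 4), (2, 1, 1, 2), (-1, 1, 1, 1)] 0 0 0 (by simp only [cub, q]; push_cast; ring)
  have h3111 : x ^ 3 * y ^ 1 * z ^ 1 * w ^ 1 ∈ W :=
    K [(1, 0, 3, 4), (1, 0, 1, 2)] 0 0 0 (by simp only [cub, q]; push_cast; ring)
  have h3102 : x ^ 3 * y ^ 1 * z ^ 0 * w ^ 2 ∈ W :=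
    K [(-1, 0, 4, 6), (-1, 0, 0, 2), (1, 0, 1, 3)] 0 0 1 (by simp only [cub, q]; push_cast; ring)
  have h3030 : x ^ 3 * y ^ 0 * z ^ 3 * w ^ 0 ∈ W :=
    K [(1, 2, 4, 6), (1, 3, 3, 4), (1, 0, 2, 2)] 0 0 0 (by simp only [cub, q]; push_cast; ring)
  have h3021 : x ^ 3 * y ^ 0 * z ^ 2 * w ^ 1 ∈ W :=
    K [(1, 3, 4, 6), (-1, 1, 4, 5), (-1, 0, 4, 6), (-1, 0, 0, 2), (-1, 0, 0, 1), (1, 3, 5, 5), (2, 0, 1, 3), (1, 0, 2, 3), (-1, 1, 3, 3)] 0 0 1 (by simp only [cub, q]; push_cast; ring)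
  have h3012 : x ^ 3 * y ^ 0 * z ^ 1 * w ^ 2 ∈ W :=
    K [(1, 3, 4, 5), (1, 0, 0, 3), (1, 1, 2, 5)] 0 0 0 (by simp only [cub, q]; push_cast; ring)
  have h3003 : x ^ 3 * y ^ 0 * z ^ 0 * w ^ 3 ∈ W :=
    K [(-1, 4, 5, 6), (1, 3, 4, 4), (-3, 0, 0, 6), (1, 1, 2, 4), (-2, 0, 2, 5), (3, 1, 3, 5), (2, 0, 3, 6), (-2, 1, 1, 4), (-1, 0, 4, 4)] 1 0 0 (by simp only [cub, q]; push_cast; ring)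
  have h2400 : x ^ 2 * y ^ 4 * z ^ 0 * w ^ 0 ∈ W :=
    K [(-1, 0, 0, 5), (1, 1, 3, 4), (-1, 0, 3, 5), (1, 0, 1, 4), (1, 1, 1, 2)] 0 0 0 (by simp only [cub, q]; push_cast; ring)
  have h2310 : x ^ 2 * y ^ 3 * z ^ 1 * w ^ 0 ∈ W :=
    K [(1, 1, 4, 6), (-1, 0, 5, 6), (1, 0, 1, 1), (1, 0, 1, 2), (-1, 1, 1, 3)] 0 0 0 (by simp only [cub, q]; push_cast; ring)
  have h2301 : x ^ 2 * y ^ 3 * z ^ 0 * w ^ 1 ∈ W :=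
    K [(1, 0, 0, 1)] 0 0 0 (by simp only [cub, q]; push_cast; ring)
  have h2220 : x ^ 2 * y ^ 2 * z ^ 2 * w ^ 0 ∈ W :=
    K [(1, 0, 0, 2)] 0 0 0 (by simp only [cub, q]; push_cast; ring)
  have h2211 : x ^ 2 * y ^ 2 * z ^ 1 * w ^ 1 ∈ W :=
    K [(1, 0, 0, 3)] 0 0 0 (by simp only [cub, q]; push_cast; ring)
  have h2202 : x ^ 2 * y ^ 2 * z ^ 0 * w ^ 2 ∈ W :=
    K [(-2, 0, 0, 6), (-1, 0, 4, 4), (-1, 0, 2, 5), (1, 1, 3, 5), (1, 0, 3, 6), (-1, 1, 1, 4)] 1 0 0 (by simp only [cub, q]; push_cast; ring)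
  have h2130 : x ^ 2 * y ^ 1 * z ^ 3 * w ^ 0 ∈ W :=
    K [(1, 0, 2, 6), (1, 0, 3, 3)] 0 0 0 (by simp only [cub, q]; push_cast; ring)
  have h2121 : x ^ 2 * y ^ 1 * z ^ 2 * w ^ 1 ∈ W :=
    K [(2, 1, 3, 5), (2, 0, 3, 6), (-2, 1, 1, 4), (-2, 0, 0, 6), (-1, 0, 4, 4), (-1, 0, 2, 5)] 1 0 0 (by simp only [cub, q]; push_cast; ring)
  have h2112 : x ^ 2 * y ^ 1 * z ^ 1 * w ^ 2 ∈ W :=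
    K [(1, 1, 3, 4), (1, 1, 1, 2)] 0 0 0 (by simp only [cub, q]; push_cast; ring)
  have h2103 : x ^ 2 * y ^ 1 * z ^ 0 * w ^ 3 ∈ W :=
    K [(1, 0, 3, 4), (-1, 1, 4, 6), (1, 1, 1, 3)] 0 0 0 (by simp only [cub, q]; push_cast; ring)
  have h2040 : x ^ 2 * y ^ 0 * z ^ 4 * w ^ 0 ∈ W :=
    K [(1, 2, 6, 6), (1, 2, 3, 5), (-1, 1, 2, 4), (2, 1, 3, 5), (2, 0, 3, 6), (-2, 1, 1, 4), (-2, 0, 0, 6), (-1, 0, 4, 4), (-1, 0, 2, 5), (1, 3, 3, 6)] 1 0 0 (by simp only [cub, q]; push_cast; ring)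
  have h2031 : x ^ 2 * y ^ 0 * z ^ 3 * w ^ 1 ∈ W :=
    K [(1, 2, 3, 4), (1, 1, 2, 2)] 0 0 0 (by simp only [cub, q]; push_cast; ring)
  have h2022 : x ^ 2 * y ^ 0 * z ^ 2 * w ^ 2 ∈ W :=
    K [(1, 3, 3, 4), (1, 1, 2, 3)] 0 0 0 (by simp only [cub, q]; push_cast; ring)
  have h2013 : x ^ 2 * y ^ 0 * z ^ 1 * w ^ 3 ∈ W :=
    K [(-1, 1, 4, 5), (-1, 0, 4, 6), (-1, 0, 0, 2), (-1, 0, 0, 1), (1, 3, 5, 5), (2, 0, 1, 3)] 0 0 1 (by simp only [cub, q]; push_cast; ring)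
  have h2004 : x ^ 2 * y ^ 0 * z ^ 0 * w ^ 4 ∈ W :=
    K [(1, 4, 6, 6), (-1, 2, 4, 4), (-1, 0, 2, 6), (-2, 0, 3, 3), (-1, 2, 2, 5), (1, 2, 3, 6), (1, 3, 3, 3), (2, 3, 4, 5), (2, 0, 0, 3), (2, 1, 2, 5), (-1, 1, 3, 6)] 0 0 0 (by simp only [cub, q]; push_cast; ring)
  have h1500 : x ^ 1 * y ^ 5 * z ^ 0 * w ^ 0 ∈ W :=
    K [(1, 0, 5, 5), (2, 0, 0, 1), (1, 0, 4, 6), (1, 0, 0, 2), (-1, 0, 1, 3)] 0 0 (-1) (by simp only [cub, q]; push_cast; ring)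
  have h1410 : x ^ 1 * y ^ 4 * z ^ 1 * w ^ 0 ∈ W :=
    K [(1, 0, 4, 5), (-1, 1, 4, 4), (-1, 0, 0, 3), (-1, 1, 2, 5), (1, 0, 3, 3), (1, 0, 0, 0)] 0 0 0 (by simp only [cub, q]; push_cast; ring)
  have h1401 : x ^ 1 * y ^ 4 * z ^ 0 * w ^ 1 ∈ W :=
    K [(-1, 0, 1, 5), (-2, 0, 0, 6), (-1, 0, 4, 4), (-1, 0, 2, 5), (1, 1, 3, 5), (1, 0, 3, 6), (-1, 1, 1, 4)] 1 0 0 (by simp only [cub, q]; push_cast; ring)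
  have h1320 : x ^ 1 * y ^ 3 * z ^ 2 * w ^ 0 ∈ W :=
    K [(-2, 0, 2, 5), (2, 1, 3, 5), (2, 0, 3, 6), (-2, 1, 1, 4), (-2, 0, 0, 6), (-1, 0, 4, 4)] 1 0 0 (by simp only [cub, q]; push_cast; ring)
  have h1311 : x ^ 1 * y ^ 3 * z ^ 1 * w ^ 1 ∈ W :=
    K [(1, 1, 3, 4), (-1, 0, 3, 5), (1, 1, 1, 2)] 0 0 0 (by simp only [cub, q]; push_cast; ring)
  have h1302 : x ^ 1 * y ^ 3 * z ^ 0 * w ^ 2 ∈ W :=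
    K [(1, 0, 1, 1)] 0 0 0 (by simp only [cub, q]; push_cast; ring)
  have h1230 : x ^ 1 * y ^ 2 * z ^ 3 * w ^ 0 ∈ W :=
    K [(-1, 0, 2, 4), (1, 1, 5, 6), (-1, 0, 3, 5), (1, 0, 6, 6), (2, 1, 3, 4), (2, 1, 1, 2), (-1, 1, 1, 1)] 0 0 0 (by simp only [cub, q]; push_cast; ring)
  have h1221 : x ^ 1 * y ^ 2 * z ^ 2 * w ^ 1 ∈ W :=
    K [(1, 0, 1, 2)] 0 0 0 (by simp only [cub, q]; push_cast; ring)
  have h1212 : x ^ 1 * y ^ 2 * z ^ 1 * w ^ 2 ∈ W :=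
    K [(1, 0, 1, 3)] 0 0 0 (by simp only [cub, q]; push_cast; ring)
  have h1203 : x ^ 1 * y ^ 2 * z ^ 0 * w ^ 3 ∈ W :=
    K [(-1, 0, 1, 6), (1, 0, 0, 3)] 0 0 0 (by simp only [cub, q]; push_cast; ring)
  have h1140 : x ^ 1 * y ^ 1 * z ^ 4 * w ^ 0 ∈ W :=
    K [(1, 0, 2, 2)] 0 0 0 (by simp only [cub, q]; push_cast; ring)
  have h1131 : x ^ 1 * y ^ 1 * z ^ 3 * w ^ 1 ∈ W :=
    K [(1, 0, 2, 3)] 0 0 0 (by simp only [cub, q]; push_cast; ring)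
  have h1122 : x ^ 1 * y ^ 1 * z ^ 2 * w ^ 2 ∈ W :=
    K [(1, 0, 3, 3)] 0 0 0 (by simp only [cub, q]; push_cast; ring)
  have h1113 : x ^ 1 * y ^ 1 * z ^ 1 * w ^ 3 ∈ W :=
    K [(2, 1, 3, 5), (-2, 1, 1, 4), (-2, 0, 0, 6), (-1, 0, 4, 4), (-1, 0, 2, 5), (1, 0, 3, 6)] 1 0 0 (by simp only [cub, q]; push_cast; ring)
  have h1104 : x ^ 1 * y ^ 1 * z ^ 0 * w ^ 4 ∈ W :=
    K [(-1, 1, 5, 6), (1, 0, 3, 5), (1, 1, 1, 1)] 0 0 0 (by simp only [cub, q]; push_cast; ring)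
  have h1050 : x ^ 1 * y ^ 0 * z ^ 5 * w ^ 0 ∈ W :=
    K [(1, 2, 2, 6), (1, 2, 3, 3)] 0 0 0 (by simp only [cub, q]; push_cast; ring)
  have h1041 : x ^ 1 * y ^ 0 * z ^ 4 * w ^ 1 ∈ W :=
    K [(1, 2, 3, 6), (1, 3, 3, 3)] 0 0 0 (by simp only [cub, q]; push_cast; ring)
  have h1032 : x ^ 1 * y ^ 0 * z ^ 3 * w ^ 2 ∈ W :=
    K [(1, 2, 3, 5), (-1, 1, 2, 4), (2, 1, 3, 5), (2, 0, 3, 6), (-2, 1, 1, 4), (-2, 0, 0, 6), (-1, 0, 4, 4), (-1, 0, 2, 5)] 1 0 0 (by simp only [cub, q]; push_cast; ring)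
  have h1023 : x ^ 1 * y ^ 0 * z ^ 2 * w ^ 3 ∈ W :=
    K [(1, 3, 3, 5), (1, 1, 1, 2)] 0 0 0 (by simp only [cub, q]; push_cast; ring)
  have h1014 : x ^ 1 * y ^ 0 * z ^ 1 * w ^ 4 ∈ W :=
    K [(-1, 3, 5, 6), (1, 3, 3, 4), (1, 1, 2, 3), (-1, 0, 1, 2), (1, 1, 1, 3)] 0 0 0 (by simp only [cub, q]; push_cast; ring)
  have h1005 : x ^ 1 * y ^ 0 * z ^ 0 * w ^ 5 ∈ W :=
    K [(1, 5, 6, 6), (-1, 3, 4, 6), (-1, 1, 4, 5), (-1, 0, 4, 6), (-1, 0, 0, 1), (1, 3, 5, 5), (-1, 0, 2, 3), (1, 1, 3, 3), (-1, 1, 1, 6), (1, 0, 1, 3)] 0 0 1 (by simp only [cub, q]; push_cast; ring)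
  have h0600 : x ^ 0 * y ^ 6 * z ^ 0 * w ^ 0 ∈ W :=
    K [(-1, 5, 5, 5), (-3, 0, 1, 5), (-1, 4, 5, 6), (1, 3, 4, 4), (-3, 0, 0, 6), (1, 1, 2, 4), (-2, 0, 2, 5), (3, 1, 3, 5), (2, 0, 3, 6), (-2, 1, 1, 4), (-1, 0, 4, 4)] 1 0 0 (by simp only [cub, q]; push_cast; ring)
  have h0510 : x ^ 0 * y ^ 5 * z ^ 1 * w ^ 0 ∈ W :=
    K [(-1, 4, 5, 5), (-1, 4, 4, 6), (-1, 1, 5, 6), (-1, 0, 6, 6), (1, 1, 1, 1), (-1, 0, 2, 4), (-1, 1, 1, 2), (-1, 0, 1, 4), (-1, 0, 0, 5)] 0 1 0 (by simp only [cub, q]; push_cast; ring)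
  have h0501 : x ^ 0 * y ^ 5 * z ^ 0 * w ^ 1 ∈ W :=
    K [(1, 1, 5, 5), (2, 0, 1, 1), (-1, 0, 3, 4), (1, 1, 4, 6), (-1, 1, 1, 3)] 0 0 0 (by simp only [cub, q]; push_cast; ring)
  have h0420 : x ^ 0 * y ^ 4 * z ^ 2 * w ^ 0 ∈ W :=
    K [(1, 2, 5, 5), (-1, 3, 3, 4), (-1, 1, 2, 3), (2, 0, 1, 2)] 0 0 0 (by simp only [cub, q]; push_cast; ring)
  have h0411 : x ^ 0 * y ^ 4 * z ^ 1 * w ^ 1 ∈ W :=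
    K [(1, 1, 4, 5), (1, 0, 4, 6), (1, 0, 0, 2), (1, 0, 0, 1)] 0 0 (-1) (by simp only [cub, q]; push_cast; ring)
  have h0402 : x ^ 0 * y ^ 4 * z ^ 0 * w ^ 2 ∈ W :=
    K [(-1, 1, 1, 5), (-1, 0, 1, 6), (1, 0, 0, 3)] 0 0 0 (by simp only [cub, q]; push_cast; ring)
  have h0330 : x ^ 0 * y ^ 3 * z ^ 3 * w ^ 0 ∈ W :=
    K [(1, 2, 4, 5), (2, 0, 0, 2), (-1, 3, 4, 6), (1, 1, 4, 5), (1, 0, 4, 6), (1, 0, 0, 1), (-1, 3, 5, 5), (-2, 0, 1, 3), (1, 1, 3, 3)] 0 0 (-1) (by simp only [cub, q]; push_cast; ring)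
  have h0321 : x ^ 0 * y ^ 3 * z ^ 2 * w ^ 1 ∈ W :=
    K [(-1, 1, 2, 5), (1, 0, 3, 3)] 0 0 0 (by simp only [cub, q]; push_cast; ring)
  have h0312 : x ^ 0 * y ^ 3 * z ^ 1 * w ^ 2 ∈ W :=
    K [(-2, 1, 1, 4), (-2, 0, 0, 6), (-1, 0, 4, 4), (-1, 0, 2, 5), (1, 1, 3, 5), (1, 0, 3, 6)] 1 0 0 (by simp only [cub, q]; push_cast; ring)
  have h0303 : x ^ 0 * y ^ 3 * z ^ 0 * w ^ 3 ∈ W :=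
    K [(1, 1, 1, 1)] 0 0 0 (by simp only [cub, q]; push_cast; ring)
  have h0240 : x ^ 0 * y ^ 2 * z ^ 4 * w ^ 0 ∈ W :=
    K [(-1, 2, 2, 5), (1, 2, 3, 6), (1, 3, 3, 3)] 0 0 0 (by simp only [cub, q]; push_cast; ring)
  have h0231 : x ^ 0 * y ^ 2 * z ^ 3 * w ^ 1 ∈ W :=
    K [(-1, 1, 2, 4), (2, 1, 3, 5), (2, 0, 3, 6), (-2, 1, 1, 4), (-2, 0, 0, 6), (-1, 0, 4, 4), (-1, 0, 2, 5)] 1 0 0 (by simp only [cub, q]; push_cast; ring)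
  have h0222 : x ^ 0 * y ^ 2 * z ^ 2 * w ^ 2 ∈ W :=
    K [(1, 1, 1, 2)] 0 0 0 (by simp only [cub, q]; push_cast; ring)
  have h0213 : x ^ 0 * y ^ 2 * z ^ 1 * w ^ 3 ∈ W :=
    K [(1, 1, 1, 3)] 0 0 0 (by simp only [cub, q]; push_cast; ring)
  have h0204 : x ^ 0 * y ^ 2 * z ^ 0 * w ^ 4 ∈ W :=
    K [(-1, 1, 1, 6), (1, 0, 1, 3)] 0 0 0 (by simp only [cub, q]; push_cast; ring)
  have h0150 : x ^ 0 * y ^ 1 * z ^ 5 * w ^ 0 ∈ W :=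
    K [(-1, 2, 2, 4), (1, 2, 6, 6), (1, 2, 3, 5), (-1, 1, 2, 4), (2, 1, 3, 5), (2, 0, 3, 6), (-2, 1, 1, 4), (-2, 0, 0, 6), (-1, 0, 4, 4), (-1, 0, 2, 5), (1, 3, 3, 6)] 1 0 0 (by simp only [cub, q]; push_cast; ring)
  have h0141 : x ^ 0 * y ^ 1 * z ^ 4 * w ^ 1 ∈ W :=
    K [(1, 1, 2, 2)] 0 0 0 (by simp only [cub, q]; push_cast; ring)
  have h0132 : x ^ 0 * y ^ 1 * z ^ 3 * w ^ 2 ∈ W :=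
    K [(1, 1, 2, 3)] 0 0 0 (by simp only [cub, q]; push_cast; ring)
  have h0123 : x ^ 0 * y ^ 1 * z ^ 2 * w ^ 3 ∈ W :=
    K [(1, 1, 3, 3)] 0 0 0 (by simp only [cub, q]; push_cast; ring)
  have h0114 : x ^ 0 * y ^ 1 * z ^ 1 * w ^ 4 ∈ W :=
    K [(-1, 1, 3, 6), (1, 0, 3, 3)] 0 0 0 (by simp only [cub, q]; push_cast; ring)
  have h0105 : x ^ 0 * y ^ 1 * z ^ 0 * w ^ 5 ∈ W :=
    K [(1, 1, 6, 6), (2, 1, 3, 5), (-2, 1, 1, 4), (-2, 0, 0, 6), (-1, 0, 4, 4), (-1, 0, 2, 5)] 1 0 0 (by simp only [cub, q]; push_cast; ring)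
  have h0060 : x ^ 0 * y ^ 0 * z ^ 6 * w ^ 0 ∈ W :=
    K [(1, 2, 2, 2)] 0 0 0 (by simp only [cub, q]; push_cast; ring)
  have h0051 : x ^ 0 * y ^ 0 * z ^ 5 * w ^ 1 ∈ W :=
    K [(1, 2, 2, 3)] 0 0 0 (by simp only [cub, q]; push_cast; ring)
  have h0042 : x ^ 0 * y ^ 0 * z ^ 4 * w ^ 2 ∈ W :=
    K [(1, 2, 3, 3)] 0 0 0 (by simp only [cub, q]; push_cast; ring)
  have h0033 : x ^ 0 * y ^ 0 * z ^ 3 * w ^ 3 ∈ W :=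
    K [(1, 3, 3, 3)] 0 0 0 (by simp only [cub, q]; push_cast; ring)
  have h0024 : x ^ 0 * y ^ 0 * z ^ 2 * w ^ 4 ∈ W :=
    K [(-1, 3, 3, 6), (1, 2, 3, 5), (-1, 1, 2, 4), (2, 1, 3, 5), (2, 0, 3, 6), (-2, 1, 1, 4), (-2, 0, 0, 6), (-1, 0, 4, 4), (-1, 0, 2, 5)] 1 0 0 (by simp only [cub, q]; push_cast; ring)
  have h0015 : x ^ 0 * y ^ 0 * z ^ 1 * w ^ 5 ∈ W :=
    K [(1, 3, 6, 6), (-1, 2, 3, 4), (-1, 1, 2, 2), (2, 3, 3, 5), (2, 1, 1, 2)] 0 0 0 (by simp only [cub, q]; push_cast; ring)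
  have h0006 : x ^ 0 * y ^ 0 * z ^ 0 * w ^ 6 ∈ W :=
    K [(-1, 6, 6, 6), (1, 2, 4, 6), (1, 3, 3, 4), (1, 0, 2, 2), (-3, 3, 5, 6), (-3, 0, 1, 2), (3, 1, 1, 3)] 0 0 0 (by simp only [cub, q]; push_cast; ring)
  have hi : i ≤ 6 := by omega
  have hj : j ≤ 6 - i := by omega
  have hl : l ≤ 6 - i - j := by omega
  obtain rfl : n = 6 - i - j - l := by omega
  clear hs hW h1 h2 h3 K q
  interval_cases i <;> interval_cases j <;> interval_cases l <;> assumption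

theorem finrank_hom_s10 {σ : Type*} [Fintype σ] [DecidableEq σ] (n : ℕ) :
    Module.finrank k (homogeneousSubmodule σ k n) = (Finset.finsuppAntidiag (Finset.univ : Finset σ) n).card := by
  rw [homogeneousSubmodule_eq_finsupp_supported,
    (AddMonoidAlgebra.supportedEquivFinsupp (R := k) (S := k) {d : σ →₀ ℕ | d.degree = n}).finrank_eq]
  have e : {d : σ →₀ ℕ | d.degree = n} = ↑(Finset.finsuppAntidiag (Finset.univ : Finset σ) n) := by
    ext d
    simp [Finsupp.degree_eq_sum]
  rw [e, Module.finrank_finsupp_self]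
  simp

theorem finrank_hom7 : Module.finrank k (homogeneousSubmodule (Fin 7) k 3) = 84 := by
  rw [finrank_hom_s10, Finset.card_finsuppAntidiag_nat_eq_choose]
  simp; decide

theorem finrank_hom4 : Module.finrank k (homogeneousSubmodule (Fin 4) k 6) = 84 := by
  rw [finrank_hom_s10, Finset.card_finsuppAntidiag_nat_eq_choose]
  simp; decide

instance fd_hom {m n : ℕ} : FiniteDimensional k (homogeneousSubmodule (Fin m) k n) :=
  Module.Finite.iff_fg.mpr (homogeneousSubmodule_fg (Fin m) k n)

theorem map_hom (q : Fin 7 → MvPolynomial (Fin 4) k) :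
    (homogeneousSubmodule (Fin 7) k 3).map (aeval q).toLinearMap =
      (Submodule.span k (Set.range q)) ^ 3 := by
  rw [← homogeneousSubmodule_one_pow, homogeneousSubmodule_one_eq_span_X, Submodule.map_pow,
    Submodule.map_span, ← Set.range_comp]
  congr 3
  ext i
  simp

theorem rank_nullity (q : Fin 7 → MvPolynomial (Fin 4) k) :
    Module.finrank k ((Submodule.span k (Set.range q)) ^ 3 : Submodule k (MvPolynomial (Fin 4) k)) +
      Module.finrank k (cubicRelations q) = 84 := by
  rw [← finrank_hom7 (k := k), ← map_hom]
  have := ((aeval q).toLinearMap.domRestrict (homogeneousSubmodule (Fin 7) k 3)).finrank_range_add_finrank_ker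
  rw [LinearMap.ker_domRestrict, LinearMap.range_domRestrict,
    ← Submodule.finrank_map_subtype_eq, Submodule.map_comap_subtype] at this
  exact this

theorem aeval_cub (q : Fin 7 → MvPolynomial (Fin 4) k) (l) :
    aeval q (cub (X : Fin 7 → MvPolynomial (Fin 7) k) l) = cub q l := by
  induction l with
  | nil => simp [cub]
  | cons p t ih => simp only [cub, map_add, map_mul, map_intCast, aeval_X, ih]

theorem eval_cub (q : Fin 7 → k) (l) :
    eval q (cub (X : Fin 7 → MvPolynomial (Fin 7) k) l) = cub q l := by
  induction l with
  | nil => simp [cub]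
  | cons p t ih => simp [cub, ih]

theorem cub_hom (l) : cub (X : Fin 7 → MvPolynomial (Fin 7) k) l ∈ homogeneousSubmodule (Fin 7) k 3 := by
  induction l with
  | nil => exact Submodule.zero_mem _
  | cons p t ih =>
    refine Submodule.add_mem _ ?_ ih
    rw [← zsmul_eq_mul]
    exact zsmul_mem (((isHomogeneous_X k _).mul (isHomogeneous_X k _)).mul (isHomogeneous_X k _)) _

def xq (k : Type) [Field k] : Fin 7 → MvPolynomial (Fin 4) k := Qv (X 0) (X 1) (X 2) (X 3)

def rel1 : List (ℤ × Fin 7 × Fin 7 × Fin 7) := [(1, 1, 2, 6), (-1, 0, 2, 3), (1, 1, 3, 3)]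
def rel2 : List (ℤ × Fin 7 × Fin 7 × Fin 7) :=
  [(1, 2, 5, 6), (-1, 2, 3, 4), (-1, 1, 2, 2), (-1, 0, 2, 4), (1, 1, 5, 6), (-1, 0, 3, 5), (1, 0, 6, 6), (2, 1, 3, 4), (2, 1, 1, 2), (-1, 1, 1, 1), (1, 3, 3, 5)]
def rel3 : List (ℤ × Fin 7 × Fin 7 × Fin 7) :=
  [(1, 5, 5, 6), (1, 3, 4, 5), (3, 0, 0, 3), (2, 1, 2, 5), (1, 4, 6, 6), (-1, 2, 4, 4), (-1, 0, 2, 6), (-3, 0, 3, 3), (-1, 2, 2, 5), (1, 2, 3, 6), (1, 3, 3, 3), (-1, 1, 3, 6), (-1, 0, 4, 5), (1, 1, 4, 4), (-1, 0, 0, 0), (1, 0, 1, 6), (-1, 1, 1, 5)]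

theorem rel_zero : cub (xq k) rel1 = 0 ∧ cub (xq k) rel2 = 0 ∧ cub (xq k) rel3 = 0 := by
  have q : xq k 0 = X 0 * X 1 ∧ xq k 1 = X 1 * X 3 ∧ xq k 2 = X 2 ^ 2 ∧
      xq k 3 = X 2 * X 3 ∧ xq k 4 = X 0 ^ 2 - X 1 * X 2 ∧ xq k 5 = X 0 * X 3 - X 1 ^ 2 ∧
      xq k 6 = X 0 * X 2 - X 3 ^ 2 := ⟨rfl, rfl, rfl, rfl, rfl, rfl, rfl⟩
  refine ⟨?_, ?_, ?_⟩ <;> simp only [cub, rel1, rel2, rel3, q] <;> push_cast <;> ring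

theorem three_le : 3 ≤ Module.finrank k (cubicRelations (xq k)) := by
  have m (l) (h : cub (xq k) l = 0) : cub X l ∈ cubicRelations (xq k) :=
    ⟨cub_hom l, (aeval_cub (xq k) l).trans h⟩
  have : FiniteDimensional k (cubicRelations (xq k)) :=
    Submodule.finiteDimensional_of_le (inf_le_left : _ ≤ homogeneousSubmodule (Fin 7) k 3)
  let v : Fin 3 → cubicRelations (xq k) := ![⟨_, m rel1 rel_zero.1⟩, ⟨_, m rel2 rel_zero.2.1⟩, ⟨_, m rel3 rel_zero.2.2⟩]
  have hv : LinearIndependent k v := by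
    rw [Fintype.linearIndependent_iff]
    intro g hg
    have hg' : g 0 • cub X rel1 + g 1 • cub X rel2 + g 2 • cub (X : Fin 7 → MvPolynomial (Fin 7) k) rel3 = 0 := by
      have := congrArg Subtype.val hg
      simpa [Fin.sum_univ_succ, v, add_assoc] using this
    have E (p : Fin 7 → k) := congrArg (eval p) hg'
    simp only [map_add, smul_eval, eval_cub, map_zero] at E
    have e0 := E ![0, 1, 1, 0, 0, 0, 1]
    have e1 := E ![0, 1, 0, 0, 0, 0, 0]
    have e2 := E ![1, 0, 0, 0, 0, 0, 0]
    simp [cub, rel1, rel2, rel3] at e0 e1 e2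
    intro i
    fin_cases i
    · norm_num at e0; simpa using e0
    · simpa using e1
    · simpa using e2
  simpa using hv.fintype_card_le_finrank

theorem rank_ge : 84 ≤ Module.finrank k ((Submodule.span k (Set.range (xq k))) ^ 3 : Submodule k (MvPolynomial (Fin 4) k)) + 3 := by
  set W := (Submodule.span k (Set.range (xq k))) ^ 3 with hW
  let N : Fin 3 → MvPolynomial (Fin 4) k := ![X 0 ^ 5 * X 1, X 0 ^ 5 * X 2, X 0 ^ 4 * X 1 * X 2]
  have fW : FiniteDimensional k W := by
    rw [hW, ← map_hom]; infer_instance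
  have fN : FiniteDimensional k (Submodule.span k (Set.range N)) :=
    FiniteDimensional.span_of_finite k (Set.finite_range N)
  have hN (i) : N i ∈ W ⊔ Submodule.span k (Set.range N) :=
    Submodule.mem_sup_right (Submodule.subset_span ⟨i, rfl⟩)
  have le : homogeneousSubmodule (Fin 4) k 6 ≤ W ⊔ Submodule.span k (Set.range N) := by
    intro p hp
    rw [p.as_sum]
    refine Submodule.sum_mem _ fun d hd => ?_
    have h6 : d.degree = 6 := by
      have := hp (mem_support_iff.mp hd)
      rw [Finsupp.degree_eq_weight_one]; exact this
    have := mono_mem (X 0 : MvPolynomial (Fin 4) k) (X 1) (X 2) (X 3)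
      (W ⊔ Submodule.span k (Set.range N)).toAddSubgroup
      (fun l => Submodule.mem_sup_left (by
        rw [hW, ← map_hom]; exact ⟨_, cub_hom l, aeval_cub _ l⟩))
      (hN 0) (hN 1) (hN 2) (d 0) (d 1) (d 2) (d 3)
      (by rw [← h6, Finsupp.degree_eq_sum]; simp [Fin.sum_univ_succ, add_assoc])
    have e : monomial d (coeff d p) = coeff d p • ((X 0 : MvPolynomial (Fin 4) k) ^ d 0 * X 1 ^ d 1 * X 2 ^ d 2 * X 3 ^ d 3) := by
      rw [monomial_eq, smul_eq_C_mul, Finsupp.prod_fintype _ _ (by simp)]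
      simp [Fin.prod_univ_succ, mul_assoc]
    rw [e]
    exact Submodule.smul_mem _ _ this
  have h1 := Submodule.finrank_mono le
  rw [finrank_hom4] at h1
  have h2 := Submodule.finrank_add_le_finrank_add_finrank W (Submodule.span k (Set.range N))
  have h3 : Module.finrank k (Submodule.span k (Set.range N)) ≤ 3 := by
    simpa [Set.finrank] using finrank_range_le_card (R := k) N
  omega

theorem finrank_rel (q : Fin 7 → MvPolynomial (Fin 4) k)
    (h : Submodule.span k (Set.range q) = Submodule.span k (Set.range (xq k))) :
    Module.finrank k (cubicRelations q) = 3 := by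
  have a := rank_nullity q
  have b := rank_nullity (xq k)
  rw [h] at a
  have := three_le (k := k)
  have := rank_ge (k := k)
  omega

theorem xq_indep : LinearIndependent k (xq k) := by
  rw [Fintype.linearIndependent_iff]
  intro g hg
  have E (p : Fin 4 → k) := congrArg (eval p) hg
  simp [Fin.sum_univ_succ, xq, Qv, smul_eval] at E
  have e0 := E ![1, 0, 0, 0]
  have e1 := E ![0, 1, 0, 0]
  have e2 := E ![0, 0, 1, 0]
  have e3 := E ![0, 0, 0, 1]
  have e4 := E ![1, 1, 0, 0]
  have e5 := E ![0, 1, 0, 1]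
  have e6 := E ![0, 0, 1, 1]
  simp at e0 e1 e2 e3
  simp [e0, e1, e2, e3] at e4 e5 e6
  intro i
  fin_cases i <;> simpa

theorem span_eq (q : Fin 7 → MvPolynomial (Fin 4) k) (hq : LinearIndependent k q)
    (h : ∀ i, xq k i ∈ Submodule.span k (Set.range q)) :
    Submodule.span k (Set.range q) = Submodule.span k (Set.range (xq k)) := by
  have : FiniteDimensional k (Submodule.span k (Set.range q)) :=
    FiniteDimensional.span_of_finite k (Set.finite_range q)
  symm
  apply Submodule.eq_of_le_of_finrank_eq
  · rw [Submodule.span_le]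
    rintro _ ⟨i, rfl⟩
    exact h i
  · rw [finrank_span_eq_card hq, finrank_span_eq_card xq_indep]

theorem diffOp_add (f f' g : MvPolynomial (Fin 4) k) :
    diffOp (f + f') g = diffOp f g + diffOp f' g :=
  Finsupp.sum_add_index' (h := fun m c => c • monD k m g) (by simp) (by intros; exact add_smul _ _ _)

theorem diffOp_monomial (m : Fin 4 →₀ ℕ) (c : k) (g : MvPolynomial (Fin 4) k) :
    diffOp (monomial m c) g = c • monD k m g :=
  Finsupp.sum_single_index (h := fun m c => c • monD k m g) (by simp)

theorem diffOp_sub (f f' g : MvPolynomial (Fin 4) k) :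
    diffOp (f - f') g = diffOp f g - diffOp f' g := by
  rw [eq_sub_iff_add_eq, ← diffOp_add, sub_add_cancel]

theorem diffOp_right (f g g' : MvPolynomial (Fin 4) k) :
    diffOp f (g + g') = diffOp f g + diffOp f g' := by
  simp [diffOp, Finset.sum_add_distrib]

theorem diffOp_smul (f g : MvPolynomial (Fin 4) k) (c : k) :
    diffOp f (c • g) = c • diffOp f g := by
  simp only [diffOp, map_smul, Finset.smul_sum]
  exact Finset.sum_congr rfl fun _ _ => smul_comm _ _ _

theorem diffOp_mul (i j : Fin 4) (g : MvPolynomial (Fin 4) k) :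
    diffOp (X i * X j) g = monD k (Finsupp.single i 1 + Finsupp.single j 1) g := by
  rw [X, X, monomial_mul, diffOp_monomial, mul_one, one_smul]

def gg (k : Type) [Field k] : Fin 3 → MvPolynomial (Fin 4) k :=
  ![3 * X 0 ^ 2 + 6 * (X 1 * X 2), 6 * (X 0 * X 3) + 3 * X 1 ^ 2, 6 * (X 0 * X 2) + 3 * X 3 ^ 2]

theorem xq_hom (i : Fin 7) : (xq k i).IsHomogeneous 2 := by
  have h (a b : Fin 4) : (X a * X b : MvPolynomial (Fin 4) k).IsHomogeneous 2 :=
    (isHomogeneous_X k a).mul (isHomogeneous_X k b)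
  fin_cases i <;> simp only [xq, Qv, pow_two]
  · exact h 0 1
  · exact h 1 3
  · exact h 2 2
  · exact h 2 3
  · exact (h 0 0).sub (h 1 2)
  · exact (h 0 3).sub (h 1 1)
  · exact (h 0 2).sub (h 3 3)

theorem xq_apolar (i : Fin 7) (j : Fin 3) : diffOp (xq k i) (gg k j) = 0 := by
  have p3 (a : Fin 4) : pderiv a (3 : MvPolynomial (Fin 4) k) = 0 := pderiv_C (a := 3)
  have p6 (a : Fin 4) : pderiv a (6 : MvPolynomial (Fin 4) k) = 0 := pderiv_C (a := 6)
  fin_cases i <;> fin_cases j <;>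
    simp [xq, Qv, pow_two, diffOp_sub, diffOp_mul, monD, gg, pderiv_X, p3, p6] <;>
    norm_num

theorem gg_eval (g : Fin 3 → k) (h : ∀ p, eval p (g 0 • gg k 0 + g 1 • gg k 1 + g 2 • gg k 2) = 0)
    (h3 : (3 : k) ≠ 0) : ∀ i, g i = 0 := by
  have e0 := h ![1, 0, 0, 0]
  have e1 := h ![0, 1, 0, 0]
  have e2 := h ![0, 0, 0, 1]
  simp [gg, smul_eval, h3] at e0 e1 e2
  intro i
  fin_cases i <;> simpa

theorem gg_indep (h3 : (3 : k) ≠ 0) : LinearIndependent k (gg k) := by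
  rw [Fintype.linearIndependent_iff]
  intro g hg
  refine gg_eval g (fun p => ?_) h3
  rw [← map_zero (eval p), ← hg]
  simp [Fin.sum_univ_succ, add_assoc]

theorem gram_add (p q : MvPolynomial (Fin 4) k) : gram (p + q) = gram p + gram q := by
  ext i j
  simp only [gram, Matrix.of_apply, Matrix.add_apply, coeff_add]
  split_ifs <;> ring

theorem gram_smul (c : k) (q : MvPolynomial (Fin 4) k) : gram (c • q) = c • gram q := by
  ext i j
  simp only [gram, Matrix.of_apply, Matrix.smul_apply, coeff_smul, smul_eq_mul]
  split_ifs <;> ring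

theorem gram_sq (i : Fin 4) : gram (X i ^ 2 : MvPolynomial (Fin 4) k) =
    Matrix.of fun a b => if a = i ∧ b = i then 1 else 0 := by
  ext a b
  simp only [gram, Matrix.of_apply, X_pow_eq_monomial, coeff_monomial]
  fin_cases i <;> fin_cases a <;> fin_cases b <;>
    simp [DFunLike.ext_iff, Fin.forall_fin_succ, Finsupp.single_apply]

theorem gram_mul (h2 : (2 : k) ≠ 0) (i j : Fin 4)
    (hij : i = 1 ∧ j = 2 ∨ i = 0 ∧ j = 3 ∨ i = 0 ∧ j = 2) :
    (2 : k) • gram (X i * X j : MvPolynomial (Fin 4) k) =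
    Matrix.of fun a b => if (a = i ∧ b = j) ∨ (a = j ∧ b = i) then 1 else 0 := by
  ext a b
  simp only [gram, Matrix.of_apply, Matrix.smul_apply]
  rw [X, X, monomial_mul]
  simp only [coeff_monomial]
  rcases hij with ⟨rfl, rfl⟩ | ⟨rfl, rfl⟩ | ⟨rfl, rfl⟩ <;> fin_cases a <;> fin_cases b <;>
    simp [DFunLike.ext_iff, Fin.forall_fin_succ, Finsupp.single_apply, h2]

theorem gram_gg (h2 : (2 : k) ≠ 0) (a b c : k) : gram (a • gg k 0 + b • gg k 1 + c • gg k 2) =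
    (3 : k) • !![a, 0, c, b; 0, b, a, 0; c, a, 0, 0; b, 0, 0, c] := by
  have e0 : gg k 0 = (3 : k) • X 0 ^ 2 + (3 : k) • (2 : k) • (X 1 * X 2) := by
    simp only [gg, smul_eq_C_mul, map_ofNat, Matrix.cons_val]; ring
  have e1 : gg k 1 = (3 : k) • (2 : k) • (X 0 * X 3) + (3 : k) • X 1 ^ 2 := by
    simp only [gg, smul_eq_C_mul, map_ofNat, Matrix.cons_val]; ring
  have e2 : gg k 2 = (3 : k) • (2 : k) • (X 0 * X 2) + (3 : k) • X 3 ^ 2 := by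
    simp only [gg, smul_eq_C_mul, map_ofNat, Matrix.cons_val]; ring
  simp only [e0, e1, e2, gram_add, gram_smul, gram_sq]
  rw [gram_mul h2 _ _ (by decide), gram_mul h2 _ _ (by decide), gram_mul h2 _ _ (by decide)]
  ext i j
  fin_cases i <;> fin_cases j <;> simp [mul_comm]

theorem det_zero (M : Matrix (Fin 4) (Fin 4) k) (h : M.rank ≤ 2) (f g : Fin 3 → Fin 4) :
    (M.submatrix f g).det = 0 := by
  by_contra hd
  have := Matrix.rank_of_isUnit _ ((Matrix.isUnit_iff_isUnit_det _).mpr (isUnit_iff_ne_zero.mpr hd))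
  have h' := Matrix.rank_submatrix_le M f g
  simp at this
  omega

theorem gram_rank (h2 : (2 : k) ≠ 0) (h3 : (3 : k) ≠ 0) (a b c : k)
    (h : (gram (a • gg k 0 + b • gg k 1 + c • gg k 2)).rank ≤ 2) : a = 0 ∧ b = 0 ∧ c = 0 := by
  rw [gram_gg h2] at h
  have D := det_zero _ h
  have d1 := D ![1, 2, 3] ![1, 2, 3]
  have d2 := D ![0, 1, 2] ![0, 1, 2]
  have d3 := D ![0, 1, 3] ![0, 1, 3]
  have d4 := D ![0, 2, 3] ![0, 2, 3]
  simp only [Matrix.det_fin_three, Matrix.submatrix_apply] at d1 d2 d3 d4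
  simp [h3] at d1 d2 d3 d4
  have n27 : (3 : k) * 3 * 3 ≠ 0 := by simp [h3]
  have d2' : a ^ 3 + b * c ^ 2 = 0 := by
    apply (mul_eq_zero.mp (?_ : (3 * 3 * 3 : k) * _ = 0)).resolve_left n27
    linear_combination -d2
  have d3' : b * (a * c - b ^ 2) = 0 := by
    apply (mul_eq_zero.mp (?_ : (3 * 3 * 3 : k) * _ = 0)).resolve_left n27
    linear_combination d3
  have ha : a = 0 := by
    rcases d1 with h | h
    · exact h
    · simpa [h] using d2'
  subst ha
  have hb : b = 0 := by simpa using d3'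
  subst hb
  simpa using d4

/-- There exists a 3-dimensional space `L` of quadratic forms
in `k[x₀,x₁,x₂,x₃]` such that: (i) `L` is spanned by three partial derivatives
of a homogeneous cubic `F`; (ii) `L` contains no nonzero quadratic form of rank
at most `2`; (iii) `dim K(L) = 3` exactly. In particular, for a general `L` in
the smoothable divisor the space of cubics containing the projected Veronese
`X_L` is exactly three-dimensional. -/
theorem exists_smoothable_center_with_exactly_three_cubics
    [IsAlgClosed k] (h2 : (2 : k) ≠ 0) (h3 : (3 : k) ≠ 0) :
    ∃ L : Submodule k (MvPolynomial (Fin 4) k),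
      Module.finrank k L = 3 ∧
      (∃ (F : MvPolynomial (Fin 4) k) (v₁ v₂ v₃ : Fin 4 → k), F.IsHomogeneous 3 ∧
        L = Submodule.span k {dirDeriv v₁ F, dirDeriv v₂ F, dirDeriv v₃ F}) ∧
      (∀ q ∈ L, q ≠ 0 → ¬ (gram q).rank ≤ 2) ∧
      (∀ q : Fin 7 → MvPolynomial (Fin 4) k, IsPerpBasis L q →
        Module.finrank k (cubicRelations q) = 3) := by
  have hr : Set.range (gg k) = {gg k 0, gg k 1, gg k 2} := by
    ext p
    simp [Fin.exists_fin_succ, eq_comm]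
  refine ⟨Submodule.span k (Set.range (gg k)), ?_, ?_, ?_, ?_⟩
  · rw [finrank_span_eq_card (gg_indep h3)]; simp
  · have c3 : (C 3 : MvPolynomial (Fin 4) k) = 3 := map_ofNat C 3
    have p3 (a : Fin 4) : pderiv a (3 : MvPolynomial (Fin 4) k) = 0 := pderiv_C (a := 3)
    have p6 (a : Fin 4) : pderiv a (6 : MvPolynomial (Fin 4) k) = 0 := pderiv_C (a := 6)
    have c6 : (C 6 : MvPolynomial (Fin 4) k) = 6 := map_ofNat C 6
    refine ⟨(3 : k) • (X 0 * X 0 * X 1) + (6 : k) • (X 0 * X 2 * X 3) + (3 : k) • (X 1 * X 1 * X 2)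
      + X 3 * X 3 * X 3, Pi.single 1 1, Pi.single 2 1, Pi.single 3 1, ?_, ?_⟩
    · have h (a b c : Fin 4) : (X a * X b * X c : MvPolynomial (Fin 4) k) ∈ homogeneousSubmodule (Fin 4) k 3 :=
        ((isHomogeneous_X k a).mul (isHomogeneous_X k b)).mul (isHomogeneous_X k c)
      exact Submodule.add_mem _ (Submodule.add_mem _ (Submodule.add_mem _
        (Submodule.smul_mem _ _ (h _ _ _)) (Submodule.smul_mem _ _ (h _ _ _)))
        (Submodule.smul_mem _ _ (h _ _ _))) (h _ _ _)
    · rw [hr]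
      congr 1
      congr 1
      · simp [dirDeriv, gg, Fin.sum_univ_succ, pderiv_X, Pi.single_apply, smul_eq_C_mul, c3, c6, p3, p6]; ring
      congr 1
      · simp [dirDeriv, gg, Fin.sum_univ_succ, pderiv_X, Pi.single_apply, smul_eq_C_mul, c3, c6, p3, p6]; ring
      congr 1
      · simp [dirDeriv, gg, Fin.sum_univ_succ, pderiv_X, Pi.single_apply, smul_eq_C_mul, c3, c6, p3, p6]; ring
  · intro q hq hne hrank
    rw [hr, Submodule.mem_span_triple] at hq
    obtain ⟨a, b, c, rfl⟩ := hq
    obtain ⟨rfl, rfl, rfl⟩ := gram_rank h2 h3 a b c hrank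
    simp at hne
  · rintro q ⟨hq, hs⟩
    refine finrank_rel q (span_eq q hq fun i => ?_)
    rw [← SetLike.mem_coe, hs]
    refine ⟨xq_hom i, fun f hf => ?_⟩
    rw [hr, Submodule.mem_span_triple] at hf
    obtain ⟨a, b, c, rfl⟩ := hf
    simp [diffOp_right, diffOp_smul, xq_apolar]

end
end

section
/- Let m₁ = x₀x₂ − x₁², m₂ = x₀x₄ − x₁x₃, m₃ = x₁x₄ − x₂x₃ ∈ k[x₀,x₁,x₂,x₃,x₄] be the three 2×2 minors of the matrix [[x₀, x₁, x₃], [x₁, x₂, x₄]] (the quadric generators of the ideal of a smooth cubic scroll in P⁴). Then there is no nonzero homogeneous cubic C ∈ k[y₁,y₂,y₃] with C(m₁,m₂,m₃) = 0 in k[x₀,…,x₄]. -/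
open MvPolynomial

/-- Let `m₁ = x₀x₂ − x₁²`, `m₂ = x₀x₄ − x₁x₃`,
`m₃ = x₁x₄ − x₂x₃` be the three `2 × 2` minors of `[[x₀, x₁, x₃], [x₁, x₂, x₄]]`
(the quadric generators of the ideal of a smooth cubic scroll in `P⁴`). There is
no nonzero homogeneous cubic `C ∈ k[y₁,y₂,y₃]` with `C(m₁,m₂,m₃) = 0`. -/
theorem no_cubic_relation_among_scroll_quadrics {k : Type} [Field k] [IsAlgClosed k] :
    ¬ ∃ C : MvPolynomial (Fin 3) k, C ≠ 0 ∧ C.IsHomogeneous 3 ∧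
      aeval
        ![(X 0 * X 2 - X 1 ^ 2 : MvPolynomial (Fin 5) k),
          X 0 * X 4 - X 1 * X 3,
          X 1 * X 4 - X 2 * X 3] C = 0 := by
  rintro ⟨C, hC, -, h⟩
  haveI : Infinite k := IsAlgClosed.instInfinite
  have key : X 0 * C = 0 := by
    apply MvPolynomial.funext
    intro y
    by_cases ha : y 0 = 0
    · simp [ha]
    have h2 := congrArg (aeval (![1, 0, y 0, -(y 2) / y 0, y 1] : Fin 5 → k)) h
    rw [← AlgHom.comp_apply, comp_aeval, map_zero] at h2
    have e : (fun i => (aeval (![1, 0, y 0, -(y 2) / y 0, y 1] : Fin 5 → k))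
        ((![(X 0 * X 2 - X 1 ^ 2 : MvPolynomial (Fin 5) k),
          X 0 * X 4 - X 1 * X 3,
          X 1 * X 4 - X 2 * X 3]) i)) = y := by
      funext i
      fin_cases i
      · simp
      · simp
      · simp
        field_simp
    rw [e] at h2
    rw [map_mul, map_zero, ← aeval_eq_eval]
    simp [h2]
  rcases mul_eq_zero.mp key with h0 | h0
  · exact X_ne_zero 0 h0
  · exact hC h0
end
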